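/- Let F be a finite family of closed disks (closed balls of nonnegative radius) in ℝ² that is pairwise intersecting: every two members of F have a common point. Then F has a piercing set of at most 4 points. -/

import Mathlib

namespace Danzer

/-- A quadratic form condition on a disk. -/
structure Frm where
  fd : ℕ
  G : ℕ
  fx : ℤ
  fy : ℤ
  f0 : ℤ
  A : ℕ
  B : ℕ
  H : ℕ

/-- A list of half planes together with a list of forms, one of which must hold on the half planes. -/
structure Opt where
  dom : List (ℤ × ℤ × ℤ)
  frms : List Frm

noncomputable def forceN (n : ℕ) (f : ℕ → Bool) : Bool :=
  Nat.rec (f 0) (fun k _ => f (Nat.succ k)) n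

noncomputable def forceZ (z : ℤ) (f : ℤ → Bool) : Bool :=
  Int.rec (fun n => forceN n fun m => f (Int.ofNat m)) (fun n => forceN n fun m => f (Int.negSucc m)) z

noncomputable def leZ (z : ℤ) (f : ℕ → Bool) : Bool :=
  Int.rec (fun n => forceN n f) (fun _ => false) z

/-- multiplication of integers by recursors -/
noncomputable def mulZ (a b : ℤ) : ℤ :=
  Int.rec (fun m => Int.rec (fun n => Int.ofNat (Nat.mul m n)) (fun n => Int.neg (Int.ofNat (Nat.mul m (Nat.succ n)))) b)
    (fun m => Int.rec (fun n => Int.neg (Int.ofNat (Nat.mul (Nat.succ m) n)))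
      (fun n => Int.ofNat (Nat.mul (Nat.succ m) (Nat.succ n))) b) a

noncomputable def sqZ (a : ℤ) : ℕ :=
  Int.rec (fun m => Nat.mul m m) (fun m => Nat.mul (Nat.succ m) (Nat.succ m)) a

noncomputable def absZ (a : ℤ) : ℕ :=
  Int.rec (fun m => m) (fun m => Nat.succ m) a

/-- squared distance -/
noncomputable def sqd (px py X Y : ℤ) : ℕ := Nat.add (sqZ (Int.sub X px)) (sqZ (Int.sub Y py))

noncomputable def eok (ax ay a0 : ℤ) (A B H GG : ℕ) (px py X Y : ℤ) : Bool :=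
  leZ (Int.sub (Int.add (Int.add (mulZ ax X) (mulZ ay Y)) a0)
    (Int.ofNat (Nat.add (Nat.add (Nat.mul A (sqZ X)) (Nat.mul B (sqZ Y))) (Nat.mul H (absZ Y))))) fun r =>
    Nat.ble (Nat.mul GG (sqd px py X Y)) (Nat.mul r r)

noncomputable def hok (X Y : ℤ) (d : ℤ × ℤ × ℤ) : Bool :=
  leZ (Int.add (Int.add (mulZ d.1 X) (mulZ d.2.1 Y)) d.2.2) fun _ => true

noncomputable def bAnd (a b : Bool) : Bool := Bool.rec false b a

noncomputable def allL {α : Type} (f : α → Bool) (l : List α) : Bool :=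
  List.rec true (fun a _ r => bAnd (f a) r) l
noncomputable def four (t : ℤ → ℤ → Bool) (x0 x1 y0 y1 : ℤ) : Bool :=
  bAnd (t x0 y0) (bAnd (t x1 y1) (bAnd (t x1 y0) (t x0 y1)))

noncomputable def nthL {α : Type} (k : α → Bool) (l : List α) : ℕ → Bool :=
  List.rec (motive := fun _ => ℕ → Bool) (fun _ => false)
    (fun a _ ih i => Nat.rec (k a) (fun j _ => ih j) i) l

noncomputable def normF (f : Frm) (k : Frm → Bool) : Bool :=
  forceN f.fd fun fd => forceN f.G fun G => forceZ f.fx fun fx => forceZ f.fy fun fy =>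
  forceZ f.f0 fun f0 => forceN f.A fun A => forceN f.B fun B => forceN f.H fun H => k ⟨fd, G, fx, fy, f0, A, B, H⟩

noncomputable def normL {α : Type} (g : α → (α → Bool) → Bool) (l : List α) : (List α → Bool) → Bool :=
  List.rec (motive := fun _ => (List α → Bool) → Bool) (fun k => k [])
    (fun a _ ih k => g a fun b => ih fun m => k (b :: m)) l

noncomputable def normO (o : Opt) (k : Opt → Bool) : Bool :=
  normL normF o.frms fun l => k ⟨o.dom, l⟩

noncomputable def prep (f : Frm) (px py : ℤ) (k : ℤ → ℤ → ℤ → ℕ → Bool) : Bool :=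
  forceZ (f.fx + 2 * f.fd * px) fun ax => forceZ (f.fy + 2 * f.fd * py) fun ay =>
  forceZ (f.f0 - f.fd * (px * px + py * py)) fun a0 => forceN (4 * (f.G * f.G) * (f.fd * f.fd)) fun GG => k ax ay a0 GG

noncomputable def optBox (px py x0 x1 y0 y1 : ℤ) (o : Opt) : Bool :=
  bAnd (allL (fun d => four (fun X Y => hok X Y d) x0 x1 y0 y1) o.dom)
    (allL (fun f => prep f px py fun ax ay a0 GG =>
      four (fun X Y => eok ax ay a0 f.A f.B f.H GG px py X Y) x0 x1 y0 y1) o.frms)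

noncomputable def optRay (px py x0 x1 y0 y1 : ℤ) (o : Opt) : Bool :=
  bAnd (allL (fun d => four (fun X Y => bAnd (hok X Y d) (hok X Y (d.1, d.2.1, 0))) x0 x1 y0 y1) o.dom)
    (allL (fun f => prep f px py fun ax ay a0 GG => bAnd (Nat.beq (f.A + f.B) 0)
      (four (fun X Y => bAnd (eok ax ay a0 0 0 f.H GG px py X Y)
        (eok ax ay 0 0 0 f.H GG 0 0 X Y)) x0 x1 y0 y1)) o.frms)

noncomputable def pick (t : ℤ → ℤ → ℤ → ℤ → ℤ → ℤ → Opt → Bool) (opts : List Opt) (pts : List (ℤ × ℤ))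
    (n i : ℕ) (x0 x1 y0 y1 : ℤ) : Bool :=
  nthL (fun p => nthL (t p.1 p.2 x0 x1 y0 y1) opts (Nat.mod i n)) pts (Nat.div i n)

noncomputable def cov (t : ℕ → ℤ → ℤ → ℤ → ℤ → Bool) (n : ℕ) : ℤ → ℤ → ℤ → ℤ → ℕ → (ℕ → Bool) → Bool :=
  Nat.rec (fun _ _ _ _ _ _ => false) (fun _ ih x0 x1 y0 y1 s k =>
    forceN (Nat.div s 128) fun s1 =>
    Nat.rec (motive := fun _ => Bool)
      (Bool.rec
        (forceZ (Int.ediv (Int.add y0 y1) 2) fun m => ih x0 x1 y0 m s1 fun s2 => ih x0 x1 m y1 s2 k)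
        (forceZ (Int.ediv (Int.add x0 x1) 2) fun m => ih x0 m y0 y1 s1 fun s2 => ih m x1 y0 y1 s2 k)
        (leZ (Int.sub (Int.sub x1 x0) (Int.sub y1 y0)) (fun _ => true)))
      (fun i _ => bAnd (t i x0 x1 y0 y1) (k s1)) (Nat.mod s 128)) n

noncomputable def check (opts : List Opt) (pts : List (ℤ × ℤ)) (s : ℕ) : Bool :=
  normL normO opts fun opts => forceN opts.length fun n =>
  cov (pick optBox opts pts n) 31 (-16000) 16000 (-16000) 16000 s fun s =>
  cov (pick optRay opts pts n) 20 16000 16000 (-16000) 16000 s fun s =>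
  cov (pick optRay opts pts n) 20 (-16000) (-16000) (-16000) 16000 s fun s =>
  cov (pick optRay opts pts n) 20 (-16000) 16000 16000 16000 s fun s =>
  cov (pick optRay opts pts n) 20 (-16000) 16000 (-16000) (-16000) s fun _ => true

def discO (R : ℕ) : Opt := ⟨[], [⟨1, 0, 0, 0, R * R, 1, 1, 0⟩]⟩

def slabO (a : ℤ) : List Opt :=
  [⟨[(100, 38, 0), (100, -38, 0)], [⟨1, 1000, 0, 2 * a, a * a - 1000000, 0, 0, 0⟩]⟩,
   ⟨[(-100, 38, 0), (-100, -38, 0)], [⟨1, 1000, 0, 2 * a, a * a - 1000000, 0, 0, 0⟩]⟩,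
   ⟨[(100, 38, 0), (100, -38, 0)], [⟨1, 1000, 0, -(2 * a), a * a - 1000000, 0, 0, 0⟩]⟩,
   ⟨[(-100, 38, 0), (-100, -38, 0)], [⟨1, 1000, 0, -(2 * a), a * a - 1000000, 0, 0, 0⟩]⟩,
   ⟨[], [⟨500, 1000, 0, 934 * a, (a * a - 1000000) * 500, 0, 0, 0⟩]⟩,
   ⟨[], [⟨500, 1000, 0, -(934 * a), (a * a - 1000000) * 500, 0, 0, 0⟩]⟩]

def beeO : Opt := ⟨[], [⟨1, 85, 0, 0, -7225, 0, 0, 0⟩, ⟨1, 0, 0, 0, 1000000, 1, 1, 0⟩]⟩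

def ceeO (g : ℕ) (XL XR YL YR : ℤ) : List Opt :=
  let H := 2 * max YL.natAbs YR.natAbs
  [⟨[(-1, 0, XL)], [⟨1, g, -2 * XL, 0, -(g * g) + XL * XL, 0, 0, H⟩]⟩,
   ⟨[(1, 0, -XR)], [⟨1, g, -2 * XR, 0, -(g * g) + XR * XR, 0, 0, H⟩]⟩,
   ⟨[(-1, 0, XL), (0, -1, YL)], [⟨1, g, -2 * XL, -2 * YL, -(g * g) + XL * XL + YL * YL, 0, 0, 0⟩]⟩,
   ⟨[(-1, 0, XL), (0, 1, -YR)], [⟨1, g, -2 * XL, -2 * YR, -(g * g) + XL * XL + YR * YR, 0, 0, 0⟩]⟩,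
   ⟨[(1, 0, -XR), (0, -1, YL)], [⟨1, g, -2 * XR, -2 * YL, -(g * g) + XR * XR + YL * YL, 0, 0, 0⟩]⟩,
   ⟨[(1, 0, -XR), (0, 1, -YR)], [⟨1, g, -2 * XR, -2 * YR, -(g * g) + XR * XR + YR * YR, 0, 0, 0⟩]⟩,
   ⟨[(-1, 0, XL)], [⟨1, g, -2 * XL, 0, -(g * g) + XL * XL, 0, 1, 0⟩]⟩,
   ⟨[(1, 0, -XR)], [⟨1, g, -2 * XR, 0, -(g * g) + XR * XR, 0, 1, 0⟩]⟩,
   ⟨[(0, -1, YL)], [⟨1, g, 0, -2 * YL, -(g * g) + YL * YL, 1, 0, 0⟩]⟩,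
   ⟨[(0, 1, -YR)], [⟨1, g, 0, -2 * YR, -(g * g) + YR * YR, 1, 0, 0⟩]⟩,
   ⟨[], [⟨1, g, 0, 0, -(g * g), 1, 1, 0⟩]⟩]

end Danzer

namespace Danzer

theorem forceN_eq (n : ℕ) (f : ℕ → Bool) : forceN n f = f n := by cases n <;> rfl
theorem forceZ_eq (z : ℤ) (f : ℤ → Bool) : forceZ z f = f z := by
  cases z with
  | ofNat n => exact forceN_eq n fun m => f (Int.ofNat m)
  | negSucc n => exact forceN_eq n fun m => f (Int.negSucc m)
theorem leZ_iff (z : ℤ) (f : ℕ → Bool) (h : leZ z f = true) : 0 ≤ z ∧ f z.toNat = true := by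
  cases z with
  | ofNat n => rw [show leZ (Int.ofNat n) f = forceN n f from rfl, forceN_eq] at h
               exact ⟨Int.natCast_nonneg n, h⟩
  | negSucc n => exact absurd h (by simp [leZ])
theorem bAnd_iff (a b : Bool) : bAnd a b = true ↔ a = true ∧ b = true := by
  cases a <;> cases b <;> simp [bAnd]
theorem allL_iff {α : Type} (f : α → Bool) (l : List α) : allL f l = true ↔ ∀ a ∈ l, f a = true := by
  induction l with
  | nil => simp [allL]
  | cons a l ih =>
    rw [show allL f (a :: l) = bAnd (f a) (allL f l) from rfl, bAnd_iff, ih]; simp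
theorem nthL_imp {α : Type} (k : α → Bool) (l : List α) (i : ℕ) (h : nthL k l i = true) :
    ∃ a ∈ l, k a = true := by
  induction l generalizing i with
  | nil => exact absurd h (by simp [nthL])
  | cons a l ih =>
    cases i with
    | zero => exact ⟨a, by simp, h⟩
    | succ j =>
      obtain ⟨b, hb, hk⟩ := ih j h
      exact ⟨b, by simp [hb], hk⟩
theorem normF_eq (f : Frm) (k : Frm → Bool) : normF f k = k f := by
  simp [normF, forceN_eq, forceZ_eq]
theorem normL_eq {α : Type} (g : α → (α → Bool) → Bool) (hg : ∀ a k, g a k = k a) (l : List α)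
    (k : List α → Bool) : normL g l k = k l := by
  induction l generalizing k with
  | nil => rfl
  | cons a l ih =>
    rw [show normL g (a :: l) k = g a fun b => normL g l fun m => k (b :: m) from rfl, hg, ih]
theorem normO_eq (o : Opt) (k : Opt → Bool) : normO o k = k o := by
  simp [normO, normL_eq normF normF_eq]
theorem mulZ_eq (a b : ℤ) : mulZ a b = a * b := by
  cases a <;> cases b <;> rfl
theorem sqZ_eq (a : ℤ) : (sqZ a : ℤ) = a * a := by
  cases a with
  | ofNat m => simp [sqZ]
  | negSucc m => simp [sqZ, Int.negSucc_mul_negSucc]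
theorem absZ_eq (a : ℤ) : (absZ a : ℤ) = |a| := by
  cases a with
  | ofNat m => simp [absZ]
  | negSucc m => simp [absZ, Int.negSucc_eq]; rw [abs_of_neg (by omega)]; ring

/-- the real form of the checked quantity -/
noncomputable def Rr (ax ay a0 A B H : ℝ) (c : ℂ) : ℝ :=
  ax * c.re + ay * c.im + a0 - (A * c.re ^ 2 + B * c.im ^ 2 + H * |c.im|)

def goodS (ax ay a0 A B H q : ℝ) (p : ℂ) : Set ℂ := {c | q * ‖c - p‖ ≤ Rr ax ay a0 A B H c}

theorem goodS_convex (ax ay a0 A B H q : ℝ) (p : ℂ) (hA : 0 ≤ A) (hB : 0 ≤ B) (hH : 0 ≤ H) (hq : 0 ≤ q) :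
    Convex ℝ (goodS ax ay a0 A B H q p) := by
  intro c hc d hd s t hs ht hst
  simp only [goodS, Set.mem_ofPred_eq, Rr] at *
  have h1 : ‖s • c + t • d - p‖ ≤ s * ‖c - p‖ + t * ‖d - p‖ := by
    have : s • c + t • d - p = s • (c - p) + t • (d - p) := by
      rw [smul_sub, smul_sub]
      have : s • p + t • p = p := by rw [← add_smul, hst, one_smul]
      linear_combination this
    rw [this]
    refine (norm_add_le _ _).trans ?_
    rw [norm_smul, norm_smul, Real.norm_of_nonneg hs, Real.norm_of_nonneg ht]
  have hre : (s • c + t • d).re = s * c.re + t * d.re := by simp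
  have him : (s • c + t • d).im = s * c.im + t * d.im := by simp
  rw [hre, him]
  have h2 : |s * c.im + t * d.im| ≤ s * |c.im| + t * |d.im| := by
    refine (abs_add_le _ _).trans ?_
    rw [abs_mul, abs_mul, abs_of_nonneg hs, abs_of_nonneg ht]
  have key : ∀ a b : ℝ, (s * a + t * b) ^ 2 ≤ s * a ^ 2 + t * b ^ 2 := by
    intro a b
    have : s * a ^ 2 + t * b ^ 2 - (s * a + t * b) ^ 2 = s * t * (a - b) ^ 2 := by
      have : t = 1 - s := by linarith
      subst this; ring
    nlinarith [mul_nonneg (mul_nonneg hs ht) (sq_nonneg (a - b))]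
  have e1 := mul_le_mul_of_nonneg_left h1 hq
  have e2 := mul_le_mul_of_nonneg_left h2 hH
  have e3 := mul_le_mul_of_nonneg_left (key c.re d.re) hA
  have e4 := mul_le_mul_of_nonneg_left (key c.im d.im) hB
  have e5 := mul_le_mul_of_nonneg_left hc hs
  have e6 := mul_le_mul_of_nonneg_left hd ht
  have e7 : a0 = s * a0 + t * a0 := by rw [← add_mul, hst, one_mul]
  nlinarith

theorem hplane_convex (a b e : ℝ) : Convex ℝ {c : ℂ | 0 ≤ a * c.re + b * c.im + e} := by
  intro c hc d hd s t hs ht hst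
  simp only [Set.mem_ofPred_eq] at *
  have hre : (s • c + t • d).re = s * c.re + t * d.re := by simp
  have him : (s • c + t • d).im = s * c.im + t * d.im := by simp
  rw [hre, him]
  have e7 : e = s * e + t * e := by rw [← add_mul, hst, one_mul]
  nlinarith [mul_nonneg hs hc, mul_nonneg ht hd]

theorem box_of_convex {S : Set ℂ} (hS : Convex ℝ S) (x0 x1 y0 y1 : ℝ) (h00 : (⟨x0, y0⟩ : ℂ) ∈ S)
    (h10 : (⟨x1, y0⟩ : ℂ) ∈ S) (h01 : (⟨x0, y1⟩ : ℂ) ∈ S) (h11 : (⟨x1, y1⟩ : ℂ) ∈ S)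
    (c : ℂ) (hx0 : x0 ≤ c.re) (hx1 : c.re ≤ x1) (hy0 : y0 ≤ c.im) (hy1 : c.im ≤ y1) : c ∈ S := by
  have hx : c.re ∈ segment ℝ x0 x1 := by rw [segment_eq_Icc (hx0.trans hx1)]; exact ⟨hx0, hx1⟩
  have hy : c.im ∈ segment ℝ y0 y1 := by rw [segment_eq_Icc (hy0.trans hy1)]; exact ⟨hy0, hy1⟩
  obtain ⟨s, t, hs, ht, hst, hx⟩ := hx
  obtain ⟨s', t', hs', ht', hst', hy⟩ := hy
  simp only [smul_eq_mul] at hx hy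
  have a0 : (⟨c.re, y0⟩ : ℂ) ∈ S := by
    have := hS h00 h10 hs ht hst
    convert this using 1
    apply Complex.ext
    · simp [hx]
    · simp [← add_mul, hst]
  have a1 : (⟨c.re, y1⟩ : ℂ) ∈ S := by
    have := hS h01 h11 hs ht hst
    convert this using 1
    apply Complex.ext
    · simp [hx]
    · simp [← add_mul, hst]
  have := hS a0 a1 hs' ht' hst'
  convert this using 1
  apply Complex.ext
  · simp [← add_mul, hst']
  · simp [hy]

theorem four_iff (t : ℤ → ℤ → Bool) (x0 x1 y0 y1 : ℤ) (h : four t x0 x1 y0 y1 = true) :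
    t x0 y0 = true ∧ t x1 y0 = true ∧ t x0 y1 = true ∧ t x1 y1 = true := by
  simp only [four, bAnd_iff] at h; tauto

theorem hok_sound (X Y : ℤ) (d : ℤ × ℤ × ℤ) (h : hok X Y d = true) :
    (0 : ℝ) ≤ d.1 * X + d.2.1 * Y + d.2.2 := by
  have h := (leZ_iff _ _ h).1
  rw [mulZ_eq, mulZ_eq] at h
  have h : 0 ≤ d.1 * X + d.2.1 * Y + d.2.2 := h
  exact_mod_cast h

theorem eok_sound (ax ay a0 : ℤ) (A B H q : ℕ) (px py X Y : ℤ)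
    (h : eok ax ay a0 A B H (q * q) px py X Y = true) :
    (⟨X, Y⟩ : ℂ) ∈ goodS ax ay a0 A B H q ⟨px, py⟩ := by
  obtain ⟨h0, h1⟩ := leZ_iff _ _ h
  set z := Int.sub (Int.add (Int.add (mulZ ax X) (mulZ ay Y)) a0)
    (Int.ofNat (Nat.add (Nat.add (Nat.mul A (sqZ X)) (Nat.mul B (sqZ Y))) (Nat.mul H (absZ Y)))) with hz
  have hz' : z = ax * X + ay * Y + a0 - (A * (X * X) + B * (Y * Y) + H * |Y|) := by
    rw [hz, mulZ_eq, mulZ_eq]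
    show ax * X + ay * Y + a0 - ((A * sqZ X + B * sqZ Y + H * absZ Y : ℕ) : ℤ) = _
    push_cast; rw [sqZ_eq, sqZ_eq, absZ_eq]
  have h2 := Nat.le_of_ble_eq_true h1
  have h2 : q * q * (sqd px py X Y) ≤ z.toNat * z.toNat := h2
  have h3 : (q * q : ℤ) * ((X - px) * (X - px) + (Y - py) * (Y - py)) ≤ z * z := by
    have h2' : ((q * q * (sqd px py X Y) : ℕ) : ℤ) ≤ ((z.toNat * z.toNat : ℕ) : ℤ) := by exact_mod_cast h2
    push_cast at h2'
    rw [Int.toNat_of_nonneg h0] at h2'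
    have : ((sqd px py X Y : ℕ) : ℤ) = (X - px) * (X - px) + (Y - py) * (Y - py) := by
      show ((sqZ (X - px) + sqZ (Y - py) : ℕ) : ℤ) = _
      push_cast; rw [sqZ_eq, sqZ_eq]
    rwa [this] at h2'
  have hR : (z : ℝ) = Rr ax ay a0 A B H ⟨X, Y⟩ := by
    rw [hz']; simp [Rr]; ring
  have h3' : (q * q : ℝ) * ((X - px) * (X - px) + (Y - py) * (Y - py)) ≤ z * z := by exact_mod_cast h3
  have h0' : (0 : ℝ) ≤ z := by exact_mod_cast h0
  show (q : ℝ) * ‖(⟨X, Y⟩ : ℂ) - ⟨px, py⟩‖ ≤ _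
  rw [← hR]
  refine abs_le_of_sq_le_sq' ?_ h0' |>.2
  rw [mul_pow, ← Complex.normSq_eq_norm_sq, Complex.normSq_apply]
  simp only [Complex.sub_re, Complex.sub_im]
  nlinarith

/-- the condition a form imposes on a disk with center `c` and radius `ρ` -/
def Frm.Holds (f : Frm) (c : ℂ) (ρ : ℝ) : Prop :=
  f.fd * (c.re ^ 2 + c.im ^ 2) + f.fx * c.re + f.fy * c.im + f.f0
    - (f.A * c.re ^ 2 + f.B * c.im ^ 2 + f.H * |c.im|) ≤ f.fd * (ρ ^ 2 + 2 * f.G * ρ)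

def Opt.Dom (o : Opt) (c : ℂ) : Prop := ∀ d ∈ o.dom, (0 : ℝ) ≤ d.1 * c.re + d.2.1 * c.im + d.2.2

def Opt.Valid (o : Opt) (c : ℂ) (ρ : ℝ) : Prop := o.Dom c → ∃ f ∈ o.frms, 0 < f.fd ∧ f.Holds c ρ

def toC (p : ℤ × ℤ) : ℂ := ⟨p.1, p.2⟩

/-- the set of centers for which the form and point work -/
def Frm.good (f : Frm) (p : ℤ × ℤ) : Set ℂ :=
  goodS (f.fx + 2 * f.fd * p.1) (f.fy + 2 * f.fd * p.2) (f.f0 - f.fd * (p.1 * p.1 + p.2 * p.2))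
    f.A f.B f.H (2 * f.G * f.fd) (toC p)

theorem good_sound (f : Frm) (p : ℤ × ℤ) (c : ℂ) (ρ : ℝ) (hρ : 0 ≤ ρ) (hf : 0 < f.fd) (hh : f.Holds c ρ)
    (hg : c ∈ f.good p) : ‖c - toC p‖ ≤ ρ := by
  have hg : 2 * f.G * f.fd * ‖c - toC p‖ ≤ _ := hg
  simp only [Rr] at hg
  have hd : ‖c - toC p‖ ^ 2 = (c.re - p.1) * (c.re - p.1) + (c.im - p.2) * (c.im - p.2) := by
    rw [← Complex.normSq_eq_norm_sq, Complex.normSq_apply]; simp [toC]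
  set d := ‖c - toC p‖ with hdd
  have hd0 : 0 ≤ d := norm_nonneg _
  have hfd : (0 : ℝ) < f.fd := by exact_mod_cast hf
  have hG : (0 : ℝ) ≤ f.G := by positivity
  unfold Frm.Holds at hh
  by_contra hlt
  push Not at hlt
  have : f.fd * (d ^ 2 + 2 * f.G * d) ≤ f.fd * (ρ ^ 2 + 2 * f.G * ρ) := by
    rw [hd]; nlinarith
  have := le_of_mul_le_mul_left this hfd
  nlinarith [mul_nonneg hG (sub_nonneg.2 hlt.le)]

def optGood (opts : List Opt) (pts : List (ℤ × ℤ)) (c : ℂ) : Prop :=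
  ∃ o ∈ opts, o.Dom c ∧ ∃ p ∈ pts, ∀ f ∈ o.frms, c ∈ f.good p

theorem prep_sound (f : Frm) (px py : ℤ) (k : ℤ → ℤ → ℤ → ℕ → Bool) (h : prep f px py k = true) :
    k (f.fx + 2 * f.fd * px) (f.fy + 2 * f.fd * py) (f.f0 - f.fd * (px * px + py * py))
      ((2 * f.G * f.fd) * (2 * f.G * f.fd)) = true := by
  simp only [prep, forceN_eq, forceZ_eq] at h
  rw [← h]; congr 1; ring

theorem goodS_of_eok (f : Frm) (p : ℤ × ℤ) (X Y : ℤ)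
    (h : eok (f.fx + 2 * f.fd * p.1) (f.fy + 2 * f.fd * p.2) (f.f0 - f.fd * (p.1 * p.1 + p.2 * p.2))
      f.A f.B f.H ((2 * f.G * f.fd) * (2 * f.G * f.fd)) p.1 p.2 X Y = true) : (⟨X, Y⟩ : ℂ) ∈ f.good p := by
  have := eok_sound _ _ _ _ _ _ _ _ _ _ _ h
  unfold Frm.good toC
  push_cast at this
  exact this

theorem Frm.good_convex (f : Frm) (p : ℤ × ℤ) : Convex ℝ (f.good p) :=
  goodS_convex _ _ _ _ _ _ _ _ (by positivity) (by positivity) (by positivity) (by positivity)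

def inBox (x0 x1 y0 y1 : ℤ) (c : ℂ) : Prop := x0 ≤ c.re ∧ c.re ≤ x1 ∧ y0 ≤ c.im ∧ c.im ≤ y1

theorem optBox_sound (p : ℤ × ℤ) (x0 x1 y0 y1 : ℤ) (o : Opt) (h : optBox p.1 p.2 x0 x1 y0 y1 o = true)
    (c : ℂ) (hc : inBox x0 x1 y0 y1 c) : o.Dom c ∧ ∀ f ∈ o.frms, c ∈ f.good p := by
  obtain ⟨h1, h2, h3, h4⟩ := hc
  rw [optBox, bAnd_iff, allL_iff, allL_iff] at h
  constructor
  · intro d hd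
    obtain ⟨a, b, e, g⟩ := four_iff _ _ _ _ _ (h.1 d hd)
    exact box_of_convex (hplane_convex d.1 d.2.1 d.2.2) x0 x1 y0 y1 (hok_sound _ _ _ a) (hok_sound _ _ _ b)
      (hok_sound _ _ _ e) (hok_sound _ _ _ g) c h1 h2 h3 h4
  · intro f hf
    obtain ⟨a, b, e, g⟩ := four_iff _ _ _ _ _ (prep_sound _ _ _ _ (h.2 f hf))
    exact box_of_convex (f.good_convex p) x0 x1 y0 y1 (goodS_of_eok _ _ _ _ a) (goodS_of_eok _ _ _ _ b)
      (goodS_of_eok _ _ _ _ e) (goodS_of_eok _ _ _ _ g) c h1 h2 h3 h4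

theorem optRay_sound (p : ℤ × ℤ) (x0 x1 y0 y1 : ℤ) (o : Opt) (h : optRay p.1 p.2 x0 x1 y0 y1 o = true)
    (c : ℂ) (hc : inBox x0 x1 y0 y1 c) (t : ℝ) (ht : 1 ≤ t) :
    o.Dom (t • c) ∧ ∀ f ∈ o.frms, t • c ∈ f.good p := by
  obtain ⟨h1, h2, h3, h4⟩ := hc
  have hre : (t • c).re = t * c.re := by simp
  have him : (t • c).im = t * c.im := by simp
  rw [optRay, bAnd_iff, allL_iff, allL_iff] at h
  constructor
  · intro d hd
    obtain ⟨a, b, e, g⟩ := four_iff _ _ _ _ _ (h.1 d hd)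
    rw [bAnd_iff] at a b e g
    have k1 := box_of_convex (hplane_convex d.1 d.2.1 d.2.2) x0 x1 y0 y1 (hok_sound _ _ _ a.1) (hok_sound _ _ _ b.1)
      (hok_sound _ _ _ e.1) (hok_sound _ _ _ g.1) c h1 h2 h3 h4
    have k2 := box_of_convex (hplane_convex d.1 d.2.1 ((0 : ℤ) : ℝ)) x0 x1 y0 y1 (hok_sound _ _ _ a.2)
      (hok_sound _ _ _ b.2) (hok_sound _ _ _ e.2) (hok_sound _ _ _ g.2) c h1 h2 h3 h4
    simp only [Set.mem_ofPred_eq] at k1 k2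
    rw [hre, him]
    push_cast at k2
    nlinarith [mul_nonneg (sub_nonneg.2 ht) k2]
  · intro f hf
    have hh := prep_sound _ _ _ _ (h.2 f hf)
    rw [bAnd_iff] at hh
    have hAB : f.A + f.B = 0 := Nat.eq_of_beq_eq_true hh.1
    have hA : f.A = 0 := by omega
    have hB : f.B = 0 := by omega
    obtain ⟨a, b, e, g⟩ := four_iff _ _ _ _ _ hh.2
    rw [bAnd_iff] at a b e g
    have k1 : c ∈ f.good p := by
      refine box_of_convex (f.good_convex p) x0 x1 y0 y1 (goodS_of_eok _ _ _ _ ?_) (goodS_of_eok _ _ _ _ ?_)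
        (goodS_of_eok _ _ _ _ ?_) (goodS_of_eok _ _ _ _ ?_) c h1 h2 h3 h4 <;> rw [hA, hB]
      exacts [a.1, b.1, e.1, g.1]
    have k2 := box_of_convex (goodS_convex _ _ _ _ _ _ _ _ (by positivity) (by positivity) (by positivity)
      (by positivity)) x0 x1 y0 y1 (eok_sound _ _ _ _ _ _ _ _ _ _ _ a.2) (eok_sound _ _ _ _ _ _ _ _ _ _ _ b.2)
      (eok_sound _ _ _ _ _ _ _ _ _ _ _ e.2) (eok_sound _ _ _ _ _ _ _ _ _ _ _ g.2) c h1 h2 h3 h4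
    unfold Frm.good at k1 ⊢
    simp only [goodS, Set.mem_ofPred_eq, Rr, hA, hB] at k1 k2 ⊢
    push_cast at k1 k2 ⊢
    have hz : (⟨0, 0⟩ : ℂ) = 0 := rfl
    rw [hz, sub_zero] at k2
    have h0 : ‖t • c - toC p‖ ≤ ‖c - toC p‖ + (t - 1) * ‖c‖ := by
      have : t • c - toC p = (c - toC p) + (t - 1) • c := by rw [sub_smul, one_smul]; ring
      rw [this]
      refine (norm_add_le _ _).trans ?_
      rw [norm_smul, Real.norm_of_nonneg (sub_nonneg.2 ht)]
    rw [hre, him, abs_mul, abs_of_nonneg (by linarith : (0 : ℝ) ≤ t)]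
    have hq : (0 : ℝ) ≤ 2 * f.G * f.fd := by positivity
    have e1 := mul_le_mul_of_nonneg_left h0 hq
    have e2 := mul_le_mul_of_nonneg_left k2 (sub_nonneg.2 ht)
    nlinarith

theorem pick_sound (t : ℤ → ℤ → ℤ → ℤ → ℤ → ℤ → Opt → Bool) (opts : List Opt) (pts : List (ℤ × ℤ))
    (n i : ℕ) (x0 x1 y0 y1 : ℤ) (h : pick t opts pts n i x0 x1 y0 y1 = true) :
    ∃ o ∈ opts, ∃ p ∈ pts, t p.1 p.2 x0 x1 y0 y1 o = true := by
  obtain ⟨p, hp, h⟩ := nthL_imp _ _ _ h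
  obtain ⟨o, ho, h⟩ := nthL_imp _ _ _ h
  exact ⟨o, ho, p, hp, h⟩

theorem cov_sound (Q : ℂ → Prop) (t : ℕ → ℤ → ℤ → ℤ → ℤ → Bool)
    (ht : ∀ i x0 x1 y0 y1, t i x0 x1 y0 y1 = true → ∀ c, inBox x0 x1 y0 y1 c → Q c) (n : ℕ) :
    ∀ (x0 x1 y0 y1 : ℤ) (s : ℕ) (k : ℕ → Bool), cov t n x0 x1 y0 y1 s k = true →
      (∀ c, inBox x0 x1 y0 y1 c → Q c) ∧ ∃ s', k s' = true := by
  induction n with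
  | zero => intro x0 x1 y0 y1 s k h; exact absurd h (by simp [cov])
  | succ n ih =>
    intro x0 x1 y0 y1 s k h
    have h : forceN (Nat.div s 128) (fun s1 =>
      Nat.rec (motive := fun _ => Bool)
      (Bool.rec
        (forceZ (Int.ediv (Int.add y0 y1) 2) fun m => cov t n x0 x1 y0 m s1 fun s2 => cov t n x0 x1 m y1 s2 k)
        (forceZ (Int.ediv (Int.add x0 x1) 2) fun m => cov t n x0 m y0 y1 s1 fun s2 => cov t n m x1 y0 y1 s2 k)
        (leZ (Int.sub (Int.sub x1 x0) (Int.sub y1 y0)) (fun _ => true)))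
      (fun i _ => bAnd (t i x0 x1 y0 y1) (k s1)) (Nat.mod s 128)) = true := h
    rw [forceN_eq] at h
    generalize Nat.div s 128 = s1 at h
    generalize Nat.mod s 128 = i at h
    cases i with
    | succ i =>
      have h := (bAnd_iff _ _).1 h
      exact ⟨ht _ _ _ _ _ h.1, _, h.2⟩
    | zero =>
      generalize leZ (Int.sub (Int.sub x1 x0) (Int.sub y1 y0)) (fun _ => true) = b at h
      cases b with
      | false =>
        simp only [forceZ_eq] at h
        obtain ⟨h1, s2, h⟩ := ih _ _ _ _ _ _ h
        obtain ⟨h2, s3, h⟩ := ih _ _ _ _ _ _ h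
        refine ⟨fun c hc => ?_, s3, h⟩
        obtain ⟨a, b, d, e⟩ := hc
        rcases le_total c.im ((Int.ediv (Int.add y0 y1) 2 : ℤ) : ℝ) with hh | hh
        · exact h1 c ⟨a, b, d, hh⟩
        · exact h2 c ⟨a, b, hh, e⟩
      | true =>
        simp only [forceZ_eq] at h
        obtain ⟨h1, s2, h⟩ := ih _ _ _ _ _ _ h
        obtain ⟨h2, s3, h⟩ := ih _ _ _ _ _ _ h
        refine ⟨fun c hc => ?_, s3, h⟩
        obtain ⟨a, b, d, e⟩ := hc
        rcases le_total c.re ((Int.ediv (Int.add x0 x1) 2 : ℤ) : ℝ) with hh | hh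
        · exact h1 c ⟨a, hh, d, e⟩
        · exact h2 c ⟨hh, b, d, e⟩

theorem check_optGood (opts : List Opt) (pts : List (ℤ × ℤ)) (s : ℕ) (h : check opts pts s = true) (c : ℂ) :
    optGood opts pts c := by
  rw [check, normL_eq normO normO_eq, forceN_eq] at h
  have hb : ∀ i x0 x1 y0 y1, pick optBox opts pts opts.length i x0 x1 y0 y1 = true →
      ∀ c, inBox x0 x1 y0 y1 c → optGood opts pts c := by
    intro i x0 x1 y0 y1 h c hc
    obtain ⟨o, ho, p, hp, h⟩ := pick_sound _ _ _ _ _ _ _ _ _ h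
    obtain ⟨h1, h2⟩ := optBox_sound p _ _ _ _ o h c hc
    exact ⟨o, ho, h1, p, hp, h2⟩
  have hr : ∀ i x0 x1 y0 y1, pick optRay opts pts opts.length i x0 x1 y0 y1 = true →
      ∀ c, inBox x0 x1 y0 y1 c → ∀ t : ℝ, 1 ≤ t → optGood opts pts (t • c) := by
    intro i x0 x1 y0 y1 h c hc t ht
    obtain ⟨o, ho, p, hp, h⟩ := pick_sound _ _ _ _ _ _ _ _ _ h
    obtain ⟨h1, h2⟩ := optRay_sound p _ _ _ _ o h c hc t ht
    exact ⟨o, ho, h1, p, hp, h2⟩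
  obtain ⟨h0, _, h⟩ := cov_sound _ _ hb _ _ _ _ _ _ _ h
  obtain ⟨h1, _, h⟩ := cov_sound (fun c => ∀ t : ℝ, 1 ≤ t → optGood opts pts (t • c)) _ hr _ _ _ _ _ _ _ h
  obtain ⟨h2, _, h⟩ := cov_sound (fun c => ∀ t : ℝ, 1 ≤ t → optGood opts pts (t • c)) _ hr _ _ _ _ _ _ _ h
  obtain ⟨h3, _, h⟩ := cov_sound (fun c => ∀ t : ℝ, 1 ≤ t → optGood opts pts (t • c)) _ hr _ _ _ _ _ _ _ h
  obtain ⟨h4, _, h⟩ := cov_sound (fun c => ∀ t : ℝ, 1 ≤ t → optGood opts pts (t • c)) _ hr _ _ _ _ _ _ _ h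
  simp only [inBox] at h0 h1 h2 h3 h4
  push_cast at h0 h1 h2 h3 h4
  set M := max |c.re| |c.im| with hM
  have m1 := abs_le.1 (le_max_left |c.re| |c.im|)
  have m2 := abs_le.1 (le_max_right |c.re| |c.im|)
  rw [← hM] at m1 m2
  rcases le_or_gt M 16000 with hle | hgt
  · exact h0 c ⟨by linarith [m1.1], by linarith [m1.2], by linarith [m2.1], by linarith [m2.2]⟩
  have hMp : 0 < M := by linarith
  set w : ℂ := (16000 / M) • c with hw
  have hwr : w.re = 16000 / M * c.re := by simp [hw]
  have hwi : w.im = 16000 / M * c.im := by simp [hw]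
  have hc : c = (M / 16000) • w := by
    rw [hw, smul_smul]
    have : M / 16000 * (16000 / M) = 1 := by field_simp
    rw [this, one_smul]
  have ht : 1 ≤ M / 16000 := by linarith
  have hk : 0 < 16000 / M := by positivity
  have hkM : 16000 / M * M = 16000 := by field_simp
  have b1 : -16000 ≤ w.re := by rw [hwr]; nlinarith [m1.1]
  have b2 : w.re ≤ 16000 := by rw [hwr]; nlinarith [m1.2]
  have b3 : -16000 ≤ w.im := by rw [hwi]; nlinarith [m2.1]
  have b4 : w.im ≤ 16000 := by rw [hwi]; nlinarith [m2.2]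
  rw [hc]
  have hcase : M = |c.re| ∨ M = |c.im| := max_choice _ _
  rcases hcase with hh | hh
  · rcases abs_choice c.re with h' | h' <;> rw [h'] at hh
    · have : w.re = 16000 := by rw [hwr, ← hh]; exact hkM
      exact h1 w ⟨this.ge, this.le, b3, b4⟩ _ ht
    · have : w.re = -16000 := by rw [hwr]; have : c.re = -M := by linarith
                                 rw [this]; linarith
      exact h2 w ⟨this.ge, this.le, b3, b4⟩ _ ht
  · rcases abs_choice c.im with h' | h' <;> rw [h'] at hh
    · have : w.im = 16000 := by rw [hwi, ← hh]; exact hkM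
      exact h3 w ⟨b1, b2, this.ge, this.le⟩ _ ht
    · have : w.im = -16000 := by rw [hwi]; have : c.im = -M := by linarith
                                 rw [this]; linarith
      exact h4 w ⟨b1, b2, this.ge, this.le⟩ _ ht

theorem check_sound (opts : List Opt) (pts : List (ℤ × ℤ)) (s : ℕ) (h : check opts pts s = true) (c : ℂ) (ρ : ℝ)
    (hρ : 0 ≤ ρ) (hv : ∀ o ∈ opts, o.Valid c ρ) : ∃ p ∈ pts, ‖c - toC p‖ ≤ ρ := by
  obtain ⟨o, ho, hd, p, hp, hf⟩ := check_optGood opts pts s h c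
  obtain ⟨f, hfm, hf0, hh⟩ := hv o ho hd
  exact ⟨p, hp, good_sound f p c ρ hρ hf0 hh (hf f hfm)⟩

end Danzer

namespace Danzer

def arcF (sg : ℤ) (a b : ℕ) : Frm :=
  ⟨10000 + a * b, 1000, -(2000 * sg * 100 * (a + b)), -(2000 * (10000 - a * b)), 0, 0, 0, 0⟩

def arcO (sg : ℤ) (t T : ℕ) : Opt := ⟨[], [arcF sg t t, arcF sg t T, arcF sg T T]⟩

def baseO : Opt := ⟨[], [⟨1, 1000, 0, 2000, 0, 0, 0, 0⟩]⟩

def triOpts (a0 a1 b0 b1 : ℕ) : List Opt := [discO 1000, baseO, arcO (-1) a0 a1, arcO 1 b0 b1]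

theorem norm_sq_c (c : ℂ) : ‖c‖ ^ 2 = c.re ^ 2 + c.im ^ 2 := by
  rw [← Complex.normSq_eq_norm_sq, Complex.normSq_apply]; ring

theorem discO_valid (R : ℕ) (c : ℂ) (ρ : ℝ) (h : (R : ℝ) ≤ ρ) : (discO R).Valid c ρ := by
  intro _
  refine ⟨_, List.mem_singleton.2 rfl, by norm_num, ?_⟩
  have h0 : (0 : ℝ) ≤ R := by positivity
  simp only [Frm.Holds]
  push_cast
  nlinarith

theorem baseO_valid (c : ℂ) (ρ : ℝ) (h : ‖c‖ ^ 2 + 2000 * c.im ≤ ρ ^ 2 + 2000 * ρ) : baseO.Valid c ρ := by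
  intro _
  refine ⟨_, List.mem_singleton.2 rfl, by norm_num, ?_⟩
  rw [norm_sq_c] at h
  simp only [Frm.Holds]
  push_cast
  nlinarith

theorem arcO_valid (sg : ℤ) (t T : ℕ) (τ : ℝ) (h1 : t ≤ τ) (h2 : τ ≤ T) (c : ℂ) (ρ : ℝ)
    (h : (10000 + τ ^ 2) * ‖c‖ ^ 2 - 2000 * (sg * 200 * τ * c.re + (10000 - τ ^ 2) * c.im)
      ≤ (10000 + τ ^ 2) * (ρ ^ 2 + 2000 * ρ)) : (arcO sg t T).Valid c ρ := by
  intro _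
  rw [norm_sq_c] at h
  obtain ⟨x, y⟩ := c
  simp only at h
  set W := x ^ 2 + y ^ 2 - (ρ ^ 2 + 2000 * ρ) with hW
  have key : ∀ a b : ℕ, (10000 + a * b : ℝ) * W - 2000 * sg * 100 * (a + b) * x - 2000 * (10000 - a * b) * y ≤ 0 →
      0 < (arcF sg a b).fd ∧ (arcF sg a b).Holds ⟨x, y⟩ ρ := by
    intro a b hab
    refine ⟨by simp [arcF], ?_⟩
    simp only [Frm.Holds, arcF]
    push_cast
    rw [hW] at hab
    nlinarith
  by_contra hcon
  have n1 : ¬ _ := fun hh => hcon ⟨arcF sg t t, by simp [arcO], key t t hh⟩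
  have n2 : ¬ _ := fun hh => hcon ⟨arcF sg t T, by simp [arcO], key t T hh⟩
  have n3 : ¬ _ := fun hh => hcon ⟨arcF sg T T, by simp [arcO], key T T hh⟩
  push Not at n1 n2 n3
  have hF : (10000 + τ * τ : ℝ) * W - 2000 * sg * 100 * (τ + τ) * x - 2000 * (10000 - τ * τ) * y ≤ 0 := by
    rw [hW]; nlinarith
  rcases eq_or_lt_of_le (h1.trans h2) with he | hlt
  · have : τ = t := by linarith
    rw [this] at hF
    linarith
  · have id : ((T : ℝ) - t) ^ 2 * ((10000 + τ * τ : ℝ) * W - 2000 * sg * 100 * (τ + τ) * x - 2000 * (10000 - τ * τ) * y)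
      = (T - τ) ^ 2 * ((10000 + t * t : ℝ) * W - 2000 * sg * 100 * (t + t) * x - 2000 * (10000 - t * t) * y)
      + 2 * ((T - τ) * (τ - t)) * ((10000 + t * T : ℝ) * W - 2000 * sg * 100 * (t + T) * x - 2000 * (10000 - t * T) * y)
      + (τ - t) ^ 2 * ((10000 + T * T : ℝ) * W - 2000 * sg * 100 * (T + T) * x - 2000 * (10000 - T * T) * y) := by ring
    have p1 := mul_nonneg (sq_nonneg ((T : ℝ) - τ)) n1.le
    have p2 := mul_nonneg (mul_nonneg (sub_nonneg.2 h2) (sub_nonneg.2 h1)) n2.le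
    have p3 := mul_nonneg (sq_nonneg (τ - (t : ℝ))) n3.le
    have p4 := mul_nonneg (sq_nonneg ((T : ℝ) - t)) (neg_nonneg.2 hF)
    rcases eq_or_lt_of_le h1 with h1' | h1'
    · have : 0 < ((T : ℝ) - τ) ^ 2 := by apply pow_pos; linarith
      have := mul_pos this n1
      nlinarith
    · have : 0 < (τ - (t : ℝ)) ^ 2 := by apply pow_pos; linarith
      have := mul_pos this n3
      nlinarith

/-- partition trees for the triangle case -/
inductive TT where
  | empty : TT
  | leaf : List (ℤ × ℤ) → ℕ → TT
  | node : ℕ → ℕ → TT → TT → TT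

noncomputable def checkTT : TT → ℕ → ℕ → ℕ → ℕ → Bool
  | .empty, a0, a1, b0, b1 => (Nat.ble (b1 + 1) a0).or ((Nat.ble (10000 * (a1 + b1) + 38 * (a1 * b1)) 380000).or
      (Nat.ble 10001 (2 * (a0 * b0) + b0 * b0)))
  | .leaf pts s, a0, a1, b0, b1 => bAnd (Nat.ble pts.length 3) (check (triOpts a0 a1 b0 b1) pts s)
  | .node 0 m l r, a0, a1, b0, b1 => bAnd (checkTT l a0 m b0 b1) (checkTT r m a1 b0 b1)
  | .node (_ + 1) m l r, a0, a1, b0, b1 => bAnd (checkTT l a0 a1 b0 m) (checkTT r a0 a1 m b1)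

def TriHyp (τ₁ τ₃ : ℝ) (c : ℂ) (ρ : ℝ) : Prop :=
  ‖c‖ ^ 2 + 2000 * c.im ≤ ρ ^ 2 + 2000 * ρ ∧
  (10000 + τ₁ ^ 2) * ‖c‖ ^ 2 - 2000 * (-(200 * τ₁ * c.re) + (10000 - τ₁ ^ 2) * c.im)
      ≤ (10000 + τ₁ ^ 2) * (ρ ^ 2 + 2000 * ρ) ∧
  (10000 + τ₃ ^ 2) * ‖c‖ ^ 2 - 2000 * (200 * τ₃ * c.re + (10000 - τ₃ ^ 2) * c.im)
      ≤ (10000 + τ₃ ^ 2) * (ρ ^ 2 + 2000 * ρ)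

theorem checkTT_sound (τ₁ τ₃ : ℝ) (h13 : τ₁ ≤ τ₃) (hns : 380000 < 10000 * (τ₁ + τ₃) + 38 * (τ₁ * τ₃))
    (hord : 2 * (τ₁ * τ₃) + τ₃ * τ₃ ≤ 10000) (T : TT) :
    ∀ a0 a1 b0 b1 : ℕ, checkTT T a0 a1 b0 b1 = true → a0 ≤ τ₁ → τ₁ ≤ a1 → b0 ≤ τ₃ → τ₃ ≤ b1 →
    ∃ pts : List (ℤ × ℤ), pts.length ≤ 3 ∧ ∀ c ρ, 1000 ≤ ρ → TriHyp τ₁ τ₃ c ρ → ∃ p ∈ pts, ‖c - toC p‖ ≤ ρ := by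
  induction T with
  | empty =>
    intro a0 a1 b0 b1 h h1 h2 h3 h4
    exfalso
    rw [checkTT, Bool.or_eq_true, Bool.or_eq_true] at h
    have z1 : (0 : ℝ) ≤ a0 := by positivity
    have z2 : (0 : ℝ) ≤ b0 := by positivity
    rcases h with h | h | h
    · have h := Nat.le_of_ble_eq_true h
      have h : (b1 : ℝ) + 1 ≤ a0 := by exact_mod_cast h
      linarith
    · have h := Nat.le_of_ble_eq_true h
      have h : 10000 * ((a1 : ℝ) + b1) + 38 * (a1 * b1) ≤ 380000 := by exact_mod_cast h
      have := mul_le_mul h2 h4 (z2.trans h3) (by linarith)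
      linarith
    · have h := Nat.le_of_ble_eq_true h
      have h : (10001 : ℝ) ≤ 2 * (a0 * b0) + b0 * b0 := by exact_mod_cast h
      have e1 := mul_le_mul h1 h3 z2 (by linarith)
      have e2 := mul_le_mul h3 h3 z2 (by linarith)
      linarith
  | leaf pts s =>
    intro a0 a1 b0 b1 h h1 h2 h3 h4
    rw [checkTT, bAnd_iff] at h
    refine ⟨pts, Nat.le_of_ble_eq_true h.1, fun c ρ hρ hh => ?_⟩
    obtain ⟨t1, t2, t3⟩ := hh
    refine check_sound _ _ _ h.2 c ρ (by linarith) ?_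
    intro o ho
    simp only [triOpts, List.mem_cons, List.not_mem_nil, or_false] at ho
    rcases ho with rfl | rfl | rfl | rfl
    · exact discO_valid _ _ _ (by push_cast; exact hρ)
    · exact baseO_valid _ _ t1
    · exact arcO_valid _ _ _ τ₁ h1 h2 _ _ (by push_cast; linarith)
    · exact arcO_valid _ _ _ τ₃ h3 h4 _ _ (by push_cast; linarith)
  | node d m l r ihl ihr =>
    intro a0 a1 b0 b1 h h1 h2 h3 h4
    cases d with
    | zero =>
      rw [checkTT, bAnd_iff] at h
      rcases le_total τ₁ m with hh | hh
      · exact ihl _ _ _ _ h.1 h1 hh h3 h4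
      · exact ihr _ _ _ _ h.2 hh h2 h3 h4
    | succ d =>
      rw [checkTT, bAnd_iff] at h
      rcases le_total τ₃ m with hh | hh
      · exact ihl _ _ _ _ h.1 h1 h2 h3 hh
      · exact ihr _ _ _ _ h.2 h1 h2 hh h4

/-- the condition imposed on a disk by a nearly flat triangle -/
def Slab (a : ℝ) (c : ℂ) (ρ : ℝ) : Prop :=
  ∃ L, ‖c‖ ^ 2 + 2 * a * L + a ^ 2 ≤ (ρ + 1000) ^ 2 ∧ 467 * |c.im| ≤ 500 * L ∧ (38 * |c.im| ≤ 100 * |c.re| → |c.im| ≤ L)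

theorem slabO_valid (a : ℕ) (c : ℂ) (ρ : ℝ) (h : Slab a c ρ) : ∀ o ∈ slabO a, o.Valid c ρ := by
  obtain ⟨L, h1, h2, h3⟩ := h
  rw [norm_sq_c] at h1
  have ha : (0 : ℝ) ≤ a := by positivity
  have y1 := le_abs_self c.im
  have y2 := neg_abs_le c.im
  have x1 := le_abs_self c.re
  have x2 := neg_abs_le c.re
  have strong : 38 * |c.im| ≤ 100 * |c.re| → ∀ sg : ℝ, sg * c.im ≤ |c.im| →
      1 * (c.re ^ 2 + c.im ^ 2) + 2 * a * sg * c.im + (a * a - 1000000) ≤ ρ ^ 2 + 2000 * ρ := by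
    intro hh sg hsg
    have := mul_le_mul_of_nonneg_left (hsg.trans (h3 hh)) ha
    nlinarith
  have weak : ∀ sg : ℝ, sg * c.im ≤ |c.im| →
      500 * (c.re ^ 2 + c.im ^ 2) + 934 * a * sg * c.im + (a * a - 1000000) * 500 ≤ 500 * (ρ ^ 2 + 2000 * ρ) := by
    intro sg hsg
    have := mul_le_mul_of_nonneg_left (show 467 * (sg * c.im) ≤ 500 * L by linarith) ha
    nlinarith
  have A1 : 0 ≤ 100 * c.re + 38 * c.im → 0 ≤ 100 * c.re - 38 * c.im → 38 * |c.im| ≤ 100 * |c.re| := by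
    intro p q
    rcases abs_choice c.im with e | e <;> rw [e] <;> linarith
  have A2 : 0 ≤ -(100 * c.re) + 38 * c.im → 0 ≤ -(100 * c.re) - 38 * c.im → 38 * |c.im| ≤ 100 * |c.re| := by
    intro p q
    rcases abs_choice c.im with e | e <;> rw [e] <;> linarith
  intro o ho
  simp only [slabO, List.mem_cons, List.not_mem_nil, or_false] at ho
  rcases ho with rfl | rfl | rfl | rfl | rfl | rfl <;> intro hd <;>
    refine ⟨_, List.mem_singleton.2 rfl, by norm_num, ?_⟩ <;>
    simp only [Opt.Dom, List.mem_cons, List.not_mem_nil, or_false, forall_eq_or_imp, forall_eq] at hd <;>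
    simp only [Frm.Holds] <;> push_cast at hd ⊢
  · have := strong (A1 (by linarith [hd.1]) (by linarith [hd.2])) 1 (by linarith); linarith
  · have := strong (A2 (by linarith [hd.1]) (by linarith [hd.2])) 1 (by linarith); linarith
  · have := strong (A1 (by linarith [hd.1]) (by linarith [hd.2])) (-1) (by linarith); linarith
  · have := strong (A2 (by linarith [hd.1]) (by linarith [hd.2])) (-1) (by linarith); linarith
  · have := weak 1 (by linarith); linarith
  · have := weak (-1) (by linarith); linarith

theorem beeO_valid (c : ℂ) (ρ : ℝ) (h0 : 0 ≤ ρ) (h : ρ ≤ 1000 → ‖c‖ ≤ ρ + 85) : beeO.Valid c ρ := by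
  intro _
  rcases le_total ρ 1000 with hr | hr
  · have h := h hr
    have h2 := pow_le_pow_left₀ (norm_nonneg c) h 2
    rw [norm_sq_c] at h2
    refine ⟨_, List.mem_cons_self, by norm_num, ?_⟩
    simp only [Frm.Holds]; push_cast; nlinarith
  · refine ⟨⟨1, 0, 0, 0, 1000000, 1, 1, 0⟩, by simp [beeO], by norm_num, ?_⟩
    simp only [Frm.Holds]; push_cast; nlinarith

theorem ceeO_valid (g : ℕ) (XL XR YL YR : ℤ) (o : ℂ) (γ : ℝ) (hγ : γ ≤ g) (h1 : XL ≤ o.re) (h2 : o.re ≤ XR)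
    (h3 : YL ≤ o.im) (h4 : o.im ≤ YR) (c : ℂ) (ρ : ℝ) (hρ : 0 ≤ ρ) (hγ0 : 0 ≤ γ) (h : ‖c - o‖ ≤ ρ + γ) :
    ∀ q ∈ ceeO g XL XR YL YR, q.Valid c ρ := by
  have hh := pow_le_pow_left₀ (norm_nonneg (c - o)) (show ‖c - o‖ ≤ ρ + g by linarith) 2
  rw [norm_sq_c, Complex.sub_re, Complex.sub_im] at hh
  have xL : 0 ≤ -c.re + XL → c.re ^ 2 - 2 * XL * c.re + XL * XL ≤ (c.re - o.re) ^ 2 := by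
    intro q; nlinarith
  have xR : 0 ≤ c.re - XR → c.re ^ 2 - 2 * XR * c.re + XR * XR ≤ (c.re - o.re) ^ 2 := by
    intro q; nlinarith
  have yL : 0 ≤ -c.im + YL → c.im ^ 2 - 2 * YL * c.im + YL * YL ≤ (c.im - o.im) ^ 2 := by
    intro q; nlinarith
  have yR : 0 ≤ c.im - YR → c.im ^ 2 - 2 * YR * c.im + YR * YR ≤ (c.im - o.im) ^ 2 := by
    intro q; nlinarith
  have x0 := sq_nonneg (c.re - o.re)
  have y0 := sq_nonneg (c.im - o.im)
  have yH : c.im ^ 2 - ((2 * max YL.natAbs YR.natAbs : ℕ) : ℝ) * |c.im| ≤ (c.im - o.im) ^ 2 := by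
    have e : |o.im| ≤ ((max YL.natAbs YR.natAbs : ℕ) : ℝ) := by
      rw [Nat.cast_max, Nat.cast_natAbs, Nat.cast_natAbs]
      push_cast
      rw [abs_le]
      have a1 := le_max_left |(YL : ℝ)| |(YR : ℝ)|
      have a2 := le_max_right |(YL : ℝ)| |(YR : ℝ)|
      have a3 := neg_abs_le (YL : ℝ)
      have a4 := le_abs_self (YR : ℝ)
      constructor <;> linarith
    have e2 : c.im * o.im ≤ |c.im| * |o.im| := by rw [← abs_mul]; exact le_abs_self _
    have e3 := mul_le_mul_of_nonneg_left e (abs_nonneg c.im)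
    push_cast at e e3 ⊢
    nlinarith [sq_nonneg o.im]
  intro q hq
  simp only [ceeO, List.mem_cons, List.not_mem_nil, or_false] at hq
  rcases hq with rfl | rfl | rfl | rfl | rfl | rfl | rfl | rfl | rfl | rfl | rfl <;> intro hd <;>
    refine ⟨_, List.mem_singleton.2 rfl, by norm_num, ?_⟩ <;>
    simp only [Opt.Dom, List.mem_cons, List.not_mem_nil, or_false, forall_eq_or_imp, forall_eq] at hd <;>
    simp only [Frm.Holds] <;> push_cast at hd yH ⊢
  · nlinarith [xL (by linarith)]
  · nlinarith [xR (by linarith)]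
  · nlinarith [xL (by linarith [hd.1]), yL (by linarith [hd.2])]
  · nlinarith [xL (by linarith [hd.1]), yR (by linarith [hd.2])]
  · nlinarith [xR (by linarith [hd.1]), yL (by linarith [hd.2])]
  · nlinarith [xR (by linarith [hd.1]), yR (by linarith [hd.2])]
  · nlinarith [xL (by linarith)]
  · nlinarith [xR (by linarith)]
  · nlinarith [yL (by linarith)]
  · nlinarith [yR (by linarith)]
  · nlinarith

/-- partition trees for the slab case -/
inductive ST where
  | empty : ST
  | leaf : Bool → List (ℤ × ℤ) → ℕ → ST
  | node : ℕ → ℤ → ST → ST → ST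

noncomputable def checkST : ST → ℤ → ℤ → ℤ → ℤ → ℤ → ℤ → Bool
  | .empty, _, X1, Y0, _, _, G1 => (decide (X1 ≤ 0)).and ((decide (0 ≤ Y0)).and
      (decide (500 * (1000 + G1) * (1000 + G1) < 500 * (X1 * X1 + Y0 * Y0 + 1000000) + 934000 * Y0)))
  | .leaf true pts s, X0, X1, Y0, Y1, _, G1 => bAnd (Nat.ble pts.length 3)
      (check (discO 1000 :: (slabO ((1000 : ℕ) : ℤ) ++ ceeO G1.toNat X0 X1 Y0 Y1)) pts s)
  | .leaf false pts s, X0, X1, Y0, Y1, G0, G1 => bAnd (Nat.ble pts.length 4)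
      (check (discO G0.toNat :: (slabO ((1000 : ℕ) : ℤ) ++ beeO :: ceeO G1.toNat X0 X1 Y0 Y1)) pts s)
  | .node 0 m l r, X0, X1, Y0, Y1, G0, G1 => bAnd (checkST l X0 m Y0 Y1 G0 G1) (checkST r m X1 Y0 Y1 G0 G1)
  | .node 1 m l r, X0, X1, Y0, Y1, G0, G1 => bAnd (checkST l X0 X1 Y0 m G0 G1) (checkST r X0 X1 m Y1 G0 G1)
  | .node (_ + 2) m l r, X0, X1, Y0, Y1, G0, G1 => bAnd (checkST l X0 X1 Y0 Y1 G0 m) (checkST r X0 X1 Y0 Y1 m G1)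

/-- everything known about a disk in the slab case -/
def SlabHyp (o : ℂ) (g : ℝ) (c : ℂ) (ρ : ℝ) : Prop :=
  0 ≤ ρ ∧ g ≤ ρ ∧ ‖c - o‖ ≤ ρ + g ∧ (ρ ≤ 1000 → ‖c‖ ≤ ρ + 85) ∧ Slab 1000 c ρ

/-- three points for large disks, or four points for all disks -/
def Pierce (Hyp : ℂ → ℝ → Prop) : Prop :=
  (∃ pts : List ℂ, pts.length ≤ 3 ∧ ∀ c ρ, 1000 ≤ ρ → Hyp c ρ → ∃ p ∈ pts, ‖c - p‖ ≤ ρ) ∨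
  (∃ pts : List ℂ, pts.length ≤ 4 ∧ ∀ c ρ, Hyp c ρ → ∃ p ∈ pts, ‖c - p‖ ≤ ρ)

theorem Pierce.mk3 {Hyp : ℂ → ℝ → Prop} (pts : List (ℤ × ℤ)) (h : pts.length ≤ 3)
    (hp : ∀ c ρ, 1000 ≤ ρ → Hyp c ρ → ∃ p ∈ pts, ‖c - toC p‖ ≤ ρ) : Pierce Hyp := by
  refine Or.inl ⟨pts.map toC, by simpa using h, fun c ρ hr hh => ?_⟩
  obtain ⟨p, h1, h2⟩ := hp c ρ hr hh
  exact ⟨toC p, List.mem_map_of_mem h1, h2⟩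

theorem Pierce.mk4 {Hyp : ℂ → ℝ → Prop} (pts : List (ℤ × ℤ)) (h : pts.length ≤ 4)
    (hp : ∀ c ρ, Hyp c ρ → ∃ p ∈ pts, ‖c - toC p‖ ≤ ρ) : Pierce Hyp := by
  refine Or.inr ⟨pts.map toC, by simpa using h, fun c ρ hh => ?_⟩
  obtain ⟨p, h1, h2⟩ := hp c ρ hh
  exact ⟨toC p, List.mem_map_of_mem h1, h2⟩

theorem checkST_sound (o : ℂ) (g : ℝ) (hg0 : 0 ≤ g) (ho : Slab 1000 o g) (T : ST) :
    ∀ X0 X1 Y0 Y1 G0 G1 : ℤ, checkST T X0 X1 Y0 Y1 G0 G1 = true → X0 ≤ o.re → o.re ≤ X1 → Y0 ≤ o.im → o.im ≤ Y1 →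
    G0 ≤ g → g ≤ G1 → Pierce (SlabHyp o g) := by
  induction T with
  | empty =>
    intro X0 X1 Y0 Y1 G0 G1 h h1 h2 h3 h4 h5 h6
    exfalso
    simp only [checkST, Bool.and_eq_true, decide_eq_true_eq] at h
    obtain ⟨a, b, e⟩ := h
    have a : (X1 : ℝ) ≤ 0 := by exact_mod_cast a
    have b : (0 : ℝ) ≤ Y0 := by exact_mod_cast b
    have e : 500 * (1000 + G1) * (1000 + G1) < 500 * (X1 * X1 + Y0 * Y0 + 1000000) + 934000 * (Y0 : ℝ) := by
      exact_mod_cast e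
    obtain ⟨L, l1, l2, -⟩ := ho
    rw [norm_sq_c] at l1
    have := le_abs_self o.im
    have q1 : (X1 : ℝ) * X1 ≤ o.re ^ 2 := by nlinarith
    have q2 : (Y0 : ℝ) * Y0 ≤ o.im ^ 2 := by nlinarith
    have q3 : (g + 1000) ^ 2 ≤ (1000 + G1) * (1000 + G1) := by nlinarith
    nlinarith
  | leaf b pts s =>
    intro X0 X1 Y0 Y1 G0 G1 h h1 h2 h3 h4 h5 h6
    have hG : g ≤ (G1.toNat : ℝ) := by
      have := Int.self_le_toNat G1
      have : (G1 : ℝ) ≤ ((G1.toNat : ℤ) : ℝ) := by exact_mod_cast this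
      push_cast at this
      linarith
    cases b with
    | true =>
      rw [checkST, bAnd_iff] at h
      refine Pierce.mk3 pts (Nat.le_of_ble_eq_true h.1) fun c ρ hr hh => ?_
      obtain ⟨a1, a2, a3, a4, a5⟩ := hh
      refine check_sound _ _ _ h.2 c ρ a1 fun q hq => ?_
      rw [List.mem_cons, List.mem_append] at hq
      rcases hq with rfl | hq | hq
      · exact discO_valid _ _ _ (by push_cast; exact hr)
      · exact slabO_valid 1000 c ρ (by push_cast; exact a5) q hq
      · exact ceeO_valid _ _ _ _ _ o g hG h1 h2 h3 h4 c ρ a1 hg0 a3 q hq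
    | false =>
      rw [checkST, bAnd_iff] at h
      refine Pierce.mk4 pts (Nat.le_of_ble_eq_true h.1) fun c ρ hh => ?_
      obtain ⟨a1, a2, a3, a4, a5⟩ := hh
      refine check_sound _ _ _ h.2 c ρ a1 fun q hq => ?_
      rw [List.mem_cons, List.mem_append, List.mem_cons] at hq
      rcases hq with rfl | hq | rfl | hq
      · refine discO_valid _ _ _ (le_trans ?_ a2)
        rcases le_total 0 G0 with hz | hz
        · have : ((G0.toNat : ℤ) : ℝ) = G0 := by rw [Int.toNat_of_nonneg hz]
          push_cast at this
          rw [this]; exact h5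
        · rw [Int.toNat_of_nonpos hz]; simpa using hg0
      · exact slabO_valid 1000 c ρ (by push_cast; exact a5) q hq
      · exact beeO_valid c ρ a1 a4
      · exact ceeO_valid _ _ _ _ _ o g hG h1 h2 h3 h4 c ρ a1 hg0 a3 q hq
  | node d m l r ihl ihr =>
    intro X0 X1 Y0 Y1 G0 G1 h h1 h2 h3 h4 h5 h6
    match d with
    | 0 =>
      rw [checkST, bAnd_iff] at h
      rcases le_total o.re m with hh | hh
      · exact ihl _ _ _ _ _ _ h.1 h1 hh h3 h4 h5 h6
      · exact ihr _ _ _ _ _ _ h.2 hh h2 h3 h4 h5 h6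
    | 1 =>
      rw [checkST, bAnd_iff] at h
      rcases le_total o.im m with hh | hh
      · exact ihl _ _ _ _ _ _ h.1 h1 h2 h3 hh h5 h6
      · exact ihr _ _ _ _ _ _ h.2 h1 h2 hh h4 h5 h6
    | (d + 2) =>
      rw [checkST, bAnd_iff] at h
      rcases le_total g m with hh | hh
      · exact ihl _ _ _ _ _ _ h.1 h1 h2 h3 h4 h5 hh
      · exact ihr _ _ _ _ _ _ h.2 h1 h2 h3 h4 hh h6

end Danzer

namespace Danzer

noncomputable def triTree : TT :=
 (.node 0 20
  (.node 1 40
   (.node 1 20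
    (.node 0 10
     .empty
     (.node 1 10
      .empty
      (.node 0 15
       .empty
       (.node 1 15
        .empty
        (.node 0 17
         (.node 1 17
          .empty
          (.leaf [(22, -617), (-790, 402), (816, 411)] 6202560797548588547907666901417417418907691616875884371186250798829553019362822442353539155651104523829931992429097618174027603098444158883253706617117363539444492065189192990102144408503081586716844065225556412931782217190186397922784689160264193465264803589546271977883841619142332304333348519082094900515353040745421484251824730273523438497115239437902518972938632456700665811619826182949909829979618362341968117278952123611216333009359670427882529340010881650986607820652128348637831869677894651459906311896811920016767195794191686092088560885298013863016350324337320226476133176282437003757708087336033530484107212930279208638902507660524335007152445168867901265974501373732986771079965382131407411966467756691284382751257145763473615011402298666447257232834101295443756930657071036104704))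
         (.leaf [(52, -584), (-819, 374), (781, 448)] 7322691304576167408316111899120852171764078357302917666462408863922387514412887065235999415547824090662375065405639946224546146432137697398486203518854866225110252344001606086930354267295642470721681341478420253625320042356757998357378314634519501583092282877331004265114622810753099281990809345030955498077147220523277458397851215543727080759910621683052948831378940255513345477432471306921590926919321196811756154442109551167499558613342803103110534306808718458635405407705389685029341163995538373974597868265646848699254584370285352138483100747094323097993908270706824676804311427188594886263879852118918243485753248325511859506655084299106383366926097285902296314375023448429829394538110547457286482977744171576963543309162868458465721885859156399339223576387663642016836437969646979405745498793722931713146880))))))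
    (.node 0 10
     (.node 1 30
      (.node 0 5
       .empty
       (.node 1 25
        .empty
        (.node 0 7
         .empty
         (.leaf [(-94, -564), (-660, 520), (920, 276)] 38614082456835857586947558640720130341624457721855552260538322029302221828147152507013144616807439585544234701331608942223494196240891263141821549764147107161314045901208888629458101689597602410046970805512111234423998564527642333898594960577055829335459904181758053893077726631663468344437898500179270502405296303642041715985896537716000702697760764931955247940422544114333510252151991915114409454834645908642895565766757404013971952158085079650098225297966124747593535809018312005977468654176475888586821410424345807223040700135819423804251699721480279262348556984009282708962144765986365261630383560305490836940553048087601433862040813604297993024674837554301543767360784046683945853337333685644290940207988280768140716831062304557295265680047791419291466010919372112806235704523710172341249950515172384574597142008317346586084390739601161977856))))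
      (.node 0 5
       (.node 1 35
        (.node 0 2
         .empty
         (.node 1 32
          .empty
          (.leaf [(68, -485), (-595, 443), (984, 316)] 4450119127288908660446521045010095764540919776279150709502584226714221430267817044445560065262051582629300573308805245431694489544650882276062436922886809853286809539344480897187212500120601244904052392006070020945429673469892174142771402881261529519835676009792276809814292243537615892682258244038445818220448622956800751710328743281955371072914063368910336222806366213774959781004309764840993722124271097530774075369938245973560930446940725222249853932185907059130271533680553486377649123581321301970380059903097466941586397786349884299086034373159583231223446129872812496772300575346157321002327685682208264415074526023849790420474351503691094462234609251708757709341909446785504982323949993244152784469686868260686273837606206261291865763378888704)))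
        (.leaf [(29, -569), (-555, 473), (1012, 271)] 4519465919906934843101339842757316208202107893637139090294007343986463971261014939170139245421453711762964690754314638622689811782642973878562456767848513981189298984348715911336906427801469838425312909788600833891509859804412118597889513978485388662113710098760962946631727653782600235862556860873902471951634885412975974392323735728043640023392502391681584378946176996932244405556017205285361836576107447816654144894358433657684341723216625795010035947627718819851609682803075446951642705769669394391218518343849043783202022888290379102898619355997175166396267286450902693699675709459580445479874794898346032030420428809728627191811417748368892078626788550392668573403569248203107990931111424838031661153435894959749879431598594283418264544938557440))
       (.leaf [(-45, -541), (-607, 503), (948, 264)] 2704410089591891540117524684004891257828389105473886551628932770853298838387444268135021815427610964881473094925276954597640575688875951686822147137859848942204981346695591676780903220332180019481640702215119450209534208607760128848909039184209438718684574549133569459606937885197936861379243737390977216163729551615001819238656428565781407125391781271553508220462889931244721243648777910977581675038514979450527236091735251534374397770770093562816994626836401676830771698745366131783795087603687462691229427387522392835265693559310212346804924042322194391002700345918105919864826143453787813946140501922942001130831315005685327505757162567126636542974605554798773400856755907139593043968)))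
     (.node 1 30
      (.node 0 15
       (.node 1 25
        (.node 0 12
         (.node 1 22
          .empty
          (.leaf [(70, -599), (-727, 402), (876, 405)] 2739744084814549550328546443179166925436138388078219722629431648291709981101538656331524127135736059044901935200003524730600613272689261381849850078407041586387202590587510759199191278926178605453166726762808211701022170037645541694022336567038101334889179255422421088208256805872410477822078446382384235875448172013659869180367522286772257646577842729154157924305887129426170975826489588727777246349530214133659252237519070611261085723698829743337885817881230298405629294904915135691716525177798965085177466587515898259275237684481883893453319475816548645153731318768936689535698990967020894131179149688951914113855048406995893307059531683690745356038164312373773261268384230246525790883304534865919175887208447909227142190912919034845958868984535718498751791484977751144639953794294467641415091277052991333973234015638295292101506988909526151570370226315753160704))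
         (.leaf [(-34, -561), (-740, 452), (854, 348)] 378574267428502718962263474999008654811968456599346183743098953439224294937335063562890795068176447008146531102312896552440786587561468082827718400298079491006481532187363716764286138443134321515234038731875595417476824087938562989361218055196528883456122709422596183195476942067479596162718409247366125790671164184192876951145085723959887196969746854131306413718514947295088013804857169775733692173650007907269296356873477070006747418633507564981040515106314982626028598080135405667672350834819907235860450392147842044268804032543946047036619923735614832529691185868525332975370989329623577300463208985069835332476093947971979956037740822187807713550342608809660528478127692498638241714605516370121419026040821282629806963188947275401262249745358335046806674948970580446700695046043205632))
        (.leaf [(-87, -463), (-678, 521), (900, 285)] 194873284347888840814211495555353432205882395486549488256342698247273225588753182943573899286104975173034062376888769306927659542474261797692845884761617819340115367877885806154521208418973809888827800336954190320184724586354102153695757988057181085266696007775275588771609195310279298424181158484610280477410009791897359626658184472363662873093176412569282273301656877204449006903468253108231332630241938828614227234477513790542774930479250188781654018954503663818218962861008596083949775044446534241881140657784836237965713148713815888392473660104372438803995885093348623434581940260578930487438320833318660613883440091851038860228835810959762448349773943031986300843494554522253965449330530047880069120))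
       (.leaf [(-2, -585), (-752, 425), (836, 392)] 52310898946143203157259621308972117774164034262399505700367875225737341904579080835772576888479036745266461597248066034069211223796342061728322613399614974936567552551957580425409269175449387405579091623825383602157151412395905886685416397196332273075810938229113295901801353032904598147823870882067403919580731378414733974488257174077657118739921160623102113241783877159735588477162589890513743686896987972972996084003796218500196894389010870932694398741364464082620603966455405160275366093036121192642938707918201725366254847406409876504416782333152270641935894647050077671864388329577513555645340224456333608641969049008967701026972302180033733346514346099072934062918904164138665556645794281780489661523689472))
      (.leaf [(-81, -428), (-619, 517), (903, 261)] 84967692149125081412552623645302258279911655537049225759474573739053016994197171911488846254652565268788425457516190826465369947639568402938164361461899402845304930638787187935727530451991295464336691685944417477117235991663038360301571181844494668606674179959609011807902435278915588068597365530038389467554464529711411890667689292546101513824533539462826509171332098721328285507076504877520539390118150436246126070793392463985636274461637950635076910282949089957095097129204592862982630335485936323613161775340946640348647466119649839755699484624597982754041079478504223163556558176361958319587328))))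
   (.leaf [(-28, -573), (-500, 499), (1027, 219)] 37436730955255210705247843001943860418875564183245913493905225854979317486468465918186805868992170590783805942784886394384735427971706951625768914241387272411683621184007620477221001709055756214687070798034206209778174879413166573575500439711021022351553662726480722383678159440191730974636981567617145592712720712240602218451694727217354334094152767766660315214935841369086181616713687077929060140534595698608881614830889262122816484730875473945888602094026893908010187552681136889436434658843154883002574700042998710032578221710448506019894002203237062689191298764718195028736703670511507032445497078068668880509494678704206212946334524209389647687635471014059631968256))
  (.node 1 50
   (.node 1 25
    (.node 0 40
     (.node 1 12
      .empty
      (.leaf [(53, -581), (-859, 330), (735, 469)] 1204952191353645111667958530165087728696650547572634100699434789200777195044991710561343694615740592098925928377494575403833607268145576655138763566552217975360568850044995912095260333726848198748129602372662263137616134367723178946296226475540911662923920246907218751351748648420602568751167703462569100458505395227966785489227200629108355334021523442808795675367171567920717821691047814957031860226437935555624157562987990307544551938904672337356100420997536961321714211866352566775422726332229266914310171817884337261280960097560742413072246101011136530096163879902392405749553844328758690209783729936947525555718899930021366565984235960726180242418870817856418414136351475732580293124351666261550690378265951023166600483126516108653733565352941119314566658702582233178018679669085202140734275506361997551981113740409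4280337396255411507880118367272851642640638787886518370304))
     .empty)
    (.leaf [(12, -569), (-726, 403), (784, 397)] 514133121312668263926586641494854616192424187101920608214103725208394616627560148610891324600414149221748880046691605012563000842295806794622489385529688831900387986180805252545990659451271838419589368324814381565124979408411533954736335910693021250704282071246218235879849776171276990199721991101925547442574125056821312376650954958071823096862331368636133690863428705464868487809343572502413279359224152624805829455312160795988007177255743307993865554616523276962027001610240))
   (.leaf [(-251, -779), (-533, 577), (843, 178)] 605464803378335115982179369608422159291481207538537224749630587043361928545933089754767633183341433500723960812925176199855657843560807937718785303746609956162823158254342272297152423149914259085259129746902243833557147313201964236377234629686292229604927404701393987932717228652190946814334155356402439363861117779302514436694772106015534670406957674534704986355624421172099610774657534029507076582945806860844661351410847844290319471284500762776285130236832379744386875876416159957941383403143168)))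

noncomputable def slabTree : ST :=
 (.node 2 300
  (.node 0 (-625)
   (.leaf true [(-1139, 12), (11, 583), (-57, -446)] 1118219424214997906508234988101195854953046852039233436235398950551189982109329725515127447712758894707727102916172059629852314071159979123130507571035108290926366240323388975158842663482203793091372268573131935727626773069824)
   (.node 0 (-315)
    (.leaf true [(-1010, 81), (268, 493), (84, -439)] 860291815468558585548717071054962117115186411651670334194908323579379819699744760402419351404541189794332697081181385016146758704878807906545854240683532145460536150533609364217931245754633034854643729460083592923437964438191707275721154272602908700267396144978743199414772517472576770189206037267790216532837890160005252109556481322046200868114313554042901994493981525362985664512)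
    (.node 2 150
     (.leaf true [(-737, 32), (352, 433), (275, -505)] 53194080025966139092268290032584415220669565952315994689852764388095718924944511620766799734191252345090150436336151620823047251012438275726988307013855031628874988599166940002649163668756978001293284029812251668846544860848812531900973531186042385447324688798901242691738078105064150803373711593219581058716210067865486982620452325497315444310408372052606411764351081345005715423523822821891555861653145124285086506143723121362405995337960047334544205357601438227764277610209121516209333320559946461149807749767748218213920760577866119166479537084039168)
     (.node 1 300
      (.leaf true [(-733, 13), (372, 347), (400, -437)] 1252093282472832858401400855362934659288409278255850167481602346744078190345704002556672779604074560366862169187258938912660277684474422832143097344403314743248357183399689413934728251957647934569567123023758387399771379385137984249621555227130968536367077814815719540690620114830911672794272462565856839174203597098162405846488979377243645931635687563458671543732034284072357042733462386759018847874827524987727884438869479337666101011430929035500227014382517177891878346852235591379895142089812475247616243610453662521550031933150919884479735826848211622073637027344206011073404711953061971419229350272971993937996751795784496820945451034525692524735425913633013006449466464446913867972673922256662937919500644644248913948653941312985586157452006981131053283144337425206450337451028280218184680036037531700429445013336865526462974322022630321786450514479171590296741939426007715282673646772758728096132365867100810609434539652160499545076856887318234288581991210493472969472059317549040201781938081330405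68795136)
      (.leaf true [(-785, 57), (440, 451), (323, -545)] 17078130498927107219109919543259709163735565245212035683270199495364279792290755080824512732094345964279342247100131302291882834749458516346533311391340814561813250428264359872861471172646992021993787873553078922991875480625766920599598098306101041764999963288166845769811845244484620849507304214605862546350908074350425413890998131482247587241999734818121664990725757550458105793721603909482933359912541927197567993617189193310469131578690686604166537754277997302265373958863899676490715673309802746273336487496268207953932275320795250593372153736253532778685725235030064988493731048958202244390011166285255246980558780009126230860035603418298428848106151870478804449716533028929491891058876694438317664028155374199380236468186235648899029835668605764150231040)))))
  (.node 0 (-625)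
   (.leaf true [(-1060, 44), (236, 524), (110, -459)] 3783603417552820266180360227523852387427898606026178318817329562963015992539315786909772986582469464213964535727391068480378572514553497058773592501579716432891224376765324345059665056554970953744844442160365396425594299648921940790485117423378245812699134937840057718287058266353351100366625824776026001607642143902362630875488346459018621797520587208377018379638910703429335651845513953673216)
   (.node 0 (-315)
    (.node 0 (-470)
     (.leaf true [(-1021, 17), (305, 505), (241, -451)] 8677689201612697924780976232249010642123223672925930325396636705068313692958363449366552929347598773959636937440656105019007304449371574008498254702612422268354604317989065646392658878433178205913255460349121326692201165514467894583675163699462217593580668863492946757638575473293733834424855249230242987682160734857289943558491745758625333118749638506372996017820873896292762931290633649176387824127947520351300168697156767284846308225584224773695373498314045503699662121416129932927830921404481536)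
     (.node 2 450
      (.leaf true [(-971, 0), (300, 501), (332, -576)] 38164880717597581358347622016545925284280166745009647432386741348274431583984558312790987568844927137002464747111576753888314112766834378496768529916722242444451790897945785504387790139162832644499344544902070916840669157873394012884079848225785839542180490725620777358953083989311750380728296550339088037862243974507997469932873924545366824593553731051528267439600485344355093413820709976408903642180767665524785338047326496911958666158368286955500260470625645053189365865161714518774326285249518034660261625856)
      (.node 2 525
       (.node 0 (-390)
        (.leaf true [(-1016, 86), (352, 434), (188, -487)] 4525251864354393392665798393288198417173058263683442923028917997887834291189547039338790351466911047166620572486935779103953504008140182166649617683981217519460588719677350786493231371364509438280938528041684210690040158282910847887983806702749703389261357157928474950934920770834277115546780461394461562008821347101250456616554030720958007724460891531664415282687794955343344408950519675276932797066939322153765751014663567065780283845108358343501919042302791749598950277463736168905152924446670451927704090849373601671142081405754998015647856766842708053283939345437471457278796490581475328)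
        (.node 0 (-355)
         (.leaf true [(-960, 73), (369, 430), (252, -550)] 63620993863519680571220515079344355640292467373282554239323879932572926860213371323067454029948453209079023170084060093315393828064189084233206445532513881035189128631759836710439940440958512310858776669072064307331159000416285260061796703122529889058320312806751101710258239384383141787225408308216721528854808878430229383891113786862349490013881152605531909501705690522144470988135780564708572946307581686141860026001857273840578881510904487637810565369736699527620314089792574276809500636547926834314205873951694877005161182985238470909756529571229404027576032466207216905256674997811044131515723533578630591260829506497603813333672344980249639934111184421341358643177819548626740758054775020217408798044324457186220800741580720434436646304403685376)
         (.leaf true [(-928, 46), (380, 443), (266, -441)] 1246687300181719040616694842333710733097016313148145909569327017024205730864766552126517663460627876330988510892880430468489710337259687158678932134763712127110376005290503346495017742786207807861133459938084169999228870349263405144714041103509394815954679313182466757565213918279128066057440610068311730908405089113264281976566054364851256092748074908025654881159599768510546658711593519695873475349106885629392818501647062147508316540389631338783143328548902490972359072388652332974218688510351641262184519957134761163681542746505449854616039036359665711442772881769650519644358077992044730596468967563830635575775974082329757529400562803941911305217490091256826990270410093109269785284568681013809475881173238778207900072714205221387088008581070559530680472701108712556067006519558096527979987421244598666505167980086886061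384320895016516549077083599318647989800369727015009389643144453555735549503504126331115006709984528909645348900732204988560834560)))
       (.leaf false [(-1023, -141), (626, 75), (-99, 222), (-31, -253)] 930113927086695589680613980525866305588520969636415536468950079878726939051789621472528051203703549349252182082728875042191144697984167167336166839645798802330983689525033713835454910967880529305468184094927292728582443374812464148724656437634617180417302910388848988541349236287131942130220919150616154818988762072213672499805904197535592572016672464719094152016422643657934781424408512719653171028555101133258924050814969686663534126076540621389062264829892350398731814804828856311771556245872277759080172512542994594003462770102397969150276400589368134296654739813250874770229513077639274251968149057796087935871581467964807160877132922375356897233661664631446206613505443616704011478375907130247569954084810707303539789070424247837126101476375392469773292037013069424872747187898699143181152403097682281843354763264))))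
    (.node 2 450
     (.node 0 (-160)
      (.node 0 (-240)
       (.leaf true [(-878, 6), (385, 535), (358, -517)] 10378658887903292069005196339741023676237044716784103580988148797842415603300117520551371479169543932743961609173406378586031856508621721732606498230875105688718202812235811763195168158322292055824248557777970967868255296154347270564039059910186043084485908330126320492224032998481526361332522123777943435753973854111070966226229445764675023028931467975194040580201264573979110371518710759665357491267429492444531306406942191456888775663395912101842756558234798746395327104573253830307999982550623170832860535496569987679398877895740562520435653569886116161115262152540170413468231488586049271678691890307724852005109678622599550910230413426380735119173003596653336047286415049289663742303734333440)
       (.node 1 300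
        (.node 2 375
         (.leaf true [(-752, 57), (370, 368), (342, -599)] 103338484517010433630904927536350634995768693055519244247309166123733691771607507987662401044947708530101070578629499666165091109541644661105346134531059974569686563362645776503082261902975141953928913063617560093177698811902018837843633798613277891423963849897967501163551188262137973989552149687110441699617519235061105912166695023965213099130395148064143402900207445579304147762895880387201699010799198882737960775410703453056158272325890726676589846001932263283855801092477433094745055848712470440684576731719674862305699361789983314001352789446828202108575901340776829400694442400855886846175947215790722570913387577925254875598290944)
         (.leaf true [(-775, 37), (469, 473), (377, -499)] 2846930516336289439145270417812884150958896166226502354729291196116513884599270112380467517599346398676308119272825179742606808376569935049512969405255002589384475481594453351197168236911455550214082136360179465702921763270784486492801479768750996452079487652167121384564853637178385063861186402195670625117992476098576758793982056348620748199149327768962270648147056595700311545792802863291315785047262867522874014370237976852704908665210016247797620668371736799511205560262424301351973782418565739683369905469536218591691242902369690157578534754504381610818199876986646769551472050628654831401562098758790636093260020914190539538122867853062107603144320210636240441283754930582304618540867224131007197893879820708052159033346412697080080645734996586820968907186414252523792355224907375585838799908173394086470959678573413821004574771017629341896710309606954877778698695862102146646341704457525423796757550833240178805209252046059458503101483016483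6471760604366842808581864918493109385853757554688000))
        (.leaf true [(-821, 55), (463, 493), (273, -424)] 23803439795239255107843395948672940365141327318621206290462828790526085068355314843435640103053225252697205195797423407207582733637788983929524948145494378225674208232791282520041945622909634979027922102054674674470425308564138088913712788404857574650421686803029834302979399715124823905683247830575595586465153732294472208361092655846053648243784847900838396399197470293703848889443220352098570292711895189727240522727031536133309371536737604113691046575633570459107738720479440592412648013099452007056682085679608385077326770136853986557051208934539383518655860837289938095735679008489670425491273972164733126402797342197435837618523720546178901595587748240277511217213714301066773517069226609177763210256776196772046041856472791609748673263083134985436265159772692464139790995090896126125564749676544)))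
      (.node 2 375
       (.node 0 (-80)
        (.leaf true [(-744, 7), (464, 529), (392, -433)] 23803439795239255107843395948672832886378231780142772680947695984591962098184550308203238902099260838644271753725129790952164365114317504070208931801970517261213400957042398635759079725825932355514320607335190172855809982014608884498588480799089911862534692409282416720369030758538948347424020848869363976410930640336144690180520508627071194414705002282913823223930621150936211541442916960557692948432015218878023691499478986432224624804813536244172356022903612730377874054722671118603576582939535060522066905860254985141656129488937381899797829566824818948146903164019304258455085042354142098916839522372141810943382000852268915153249383315858612807298874324328665388089489001446562670896395769623517694072480074111185235710926114746661011020898242088454199695683494599166203237503998245034085343821824)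
        (.node 2 340
         (.leaf true [(-688, -4), (497, 547), (468, -478)] 2421900636395905093287249318336862083291879863509707309239747561006864111065194593581244140484978418578617553519840466285985529728039629491081267806301996204982287935495851151206997677589270399783552834850674577314940019857898787145128360412239365839492812734816867229860169704390038666787806252276044799973477130713163892705912811623226926839668099323134099383563018456054751636457921005147389113777899456778877733624514855555517058421230134780408687247401545079590856150190478554897821277401896970986376747228174099484158061026337823067177297445063144999752191414695632763576690377797429984780684183554044464253225203778770385060727272982440054044072806866104010722827214070508882851287415197671426974476572350266116771559302488595654253682120633473588646946986806358049465521663977410367861119646059773044230661345687679014061786030500302106291003384890548062471327738974048698636363598160863544114733230804623705998972850851941811179678402416659921130226228077494098828924368028498861672780733078014642839888026231927947602166867296256)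
         (.node 1 300
          (.node 0 (-40)
           (.leaf true [(-655, 5), (482, 498), (488, -534)] 1715218601471608718557094516731590233410443749074539254459304215061210682306451881658596146366907632222206744917568165054988326404967724247453015048805382819840694484206219776280613860300464195423077287023033460562444773821539644809407178383054006625822196771823514654853123120919220291238349818567779373955811293657329685325525555145431410771649202260475536479854784779250404225991044118442137484514056018181642447114118217828247339885556526139697484717985241101886019742732818455609396244589763856208026868861062056326000673164030118106138258026505556397615673877018145999602277156385887003100792648375253205650523441062467565362440673173375945529320809603521888664307919674435844366533381718039969604245364060560551804126249041780076110019355370145732627057288205282358866939202987545560669986850083298097691887665152)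
           (.node 2 360
            (.node 1 150
             (.leaf false [(-553, 19), (550, -13), (8, 244), (-8, -246)] 3091340734312200581521807652393250074522185896786408353595430249640870587807680651266350975408330505969472429504371875515591513277650271611253189581389345188372640697856527357112939708169247317415619597643584212162777051408841797879084234220040050214599900318860198149753289655194351310892162255259595508973780156434328048478244388183800013426029101202741972661721206672344938006803355482153658736201716024219695091701744452092879058083743713399093678961262271042398029423023477423442799834618750926332970674599020422690549206481975619957271120967497443055320584206194284735225322380383110525569916812993906662409207763782263187963989103232765723827594105310471625911557203754034360001685260172689187747562072640136653619155217057668470030769435607331610301756441133365664556465712143969181853508220676216251681610026126141738515367021189064917108259151091188563742768211883374320635725417870872843016687410897034876958559426392836839881438091872540260864631069466983604447402120794223354905449421312376717957673678316615432137899032552807225217671956487529139714047727283300489053132673780959449635153413972373379466464814853060929658636760172174522716397191252991689192258699844629709868026572851581100979813300424058600224266468585131519567390644558857176575295293992895937717639193571914757470973040931578071740837016744160669359139763513834916074676727005478015586652636243633759685880226455141632903948823237842887980186177831624952753771537882051160482937747814852260926188540105076728922112)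
             (.leaf true [(-579, 65), (526, 415), (361, -461)] 89833287368734724031627061442189446546783072861202708239472679583941618563431468917481266169099043558634987232167272291329050878497742306208522095510834577954603025716185001189432269533416290895264594057564827176759976681251748573984964800767738522164356090437369683549664446589069527998194572516791832024780741733305506160790604532154227501891479482651105466859014315563049444286327387468232370538670732895547282983049022599748320249310158875346255450018955226216051894793875962682462765737671181596258463257026679864095757609666715467756966013788384324326430372447460876597530245276455395249082860901430574213394187644801842454738347554297515751568850572813544876987533362525024280309232942624209715911097149330261416938596193524521829187547940182899008097750839606716849634942217354662881799147521477917928373562725678846641124193815136660132995654772343733349781054599165945724841155683361666600139321219103105190311371386229701345974299952083564089859543960773459968))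
            (.node 1 150
             (.leaf false [(-569, 19), (570, -19), (9, 295), (-8, -259)] 497794639180513233922177903397778655089676287304929900022332928042719592755906418635300050759439312337169494025371238858210912270798303045475247718538261369433739530624792002738239517396918574573233197527862105352868480530596017306057153171759847788985094136728615650381786169744019918384835548160235101246044594179134387038967676027370322383570122617222752363954785094041687012242117873946788810358489619988382391418100436400450010623714339651585133147551496488402749778426747552131418542272786527102205697251660459087263268681197447481367211449429138016254354494892483618132785469188062359302095878185730673579775176918694591503856451928659938820314398260935464755883747773068847320174298596247456129044781816450129394803436182474944014705321782309843038772668966285153427463620338585014621545722597797774635803229523779714649111517093764461202735880794667530105879004252999077702502704835905952966940084092716519292952758087388205168682287200917607903764270206939310620728097717052862727115626642142147349907992281830152325708675976180395548129364542645735829420669320890070558691463496557696735247036778050059637427739591997752516589942960972492629274103106357710016003244995279204496909922882632618882863327300679470075154137431260294181351666148262606123565056)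
             (.node 1 225
              (.leaf false [(-587, 25), (590, -27), (13, 253), (-11, -273)] 2189323976094130770115534749887801854727508532775391331458041860303597921814838764088070278950396406410940891703087222002844017253112311726075148498352377636347210878703720644516153437704943328814813336474172069391163551450041593012147571838025062093908834756455976866650248268933398290578633050539243733827557602763004319754849987244652233059997432564028462817225451609327484952630660370731215649183000840005896291830309565221059470770034598331482656671895676700354315167478439552298342458896031287488061812373141157036902660581941599122829264102201860966905122308354734705801561803980565941346539849018236286253653738245430065478436911310414280402191659280451103408022847172287114993333378905196428484364356120140435222650305824354963529308948110578240914952733928638443459604660257833658163224686171442318899059119302519113254212080354464162105070272642574366365358412301445441387396356407221084839024372562668819281391269005783501317945604660087213001460610145866835538120786593755429290932913645678977556666500560486946187256582861182881508252043986311920356532788838139702390425935663990151720879658211845740869943189478186294775487304110241346137280722272421611566974817408625996834439095836509928912326447022751100024935243264551731806311528814437600177778580573086810112)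
              (.leaf true [(-595, 60), (513, 424), (405, -555)] 3933851488595561115110780512484662521624511087070182406820652264589558035534121349523696487725230402299291426405398631583350496204842867949069035850380061148929555090258629950200988242558622928375224822512232661087014070431496296669767437974714480750291967072822660901131963458206896060631527241276835904827197089471577633391993289832534898749769134013209365845963262744748127904996740997723105825883302381579892398203265746936899227302681806175803415287674239863745860546360712380783725415692175738910073936858023425837397076993709347509245454856591533455331951988998141762779023993117152565586323607706786671219683920657080602133429392512208876317160751350324696161762538280203675022617138827785275044663643436649823331330399607206999221097277095899528578469310036531247332059582471488036411648964436422029107282911821141583286838557097421747646221358207227101944526105126445247656577457709847792503565041352966756120920064)))))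
          (.leaf true [(-668, 99), (517, 404), (309, -566)] 7642170913529750381403494539569510265513929309628062277123915936435600950720662082398767395828739888563132397718601886879913261196127195253369865327175352522010882832631576277832883699029719947517183745037016819333186322436651080161595399622707684150173706199495869427870485365272318276717314917140879371509873649788242890990242162980126733347164877138075078993945126294174107853754588699472079481649222116335054014601497525846261889125581490168046251781680236987664729079778178276702237466481100662904424382361471093488392745402005895337807997767916121160205800197469100965188939751553768396312678595781492672626800259008273015608762160750524392476770799310767541855883233922950787263630668414356681867577328857245683244046111774306371571806584858709085710465328883184558108728954023166745085956468316002814965310272382933990199932478575072109128114960954420949354725249867178434026035522178046544547218728927419175887331633346712755839769341697817026238460688255398923341055896438426099501685383233783463936))))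
       (.node 2 415
        (.node 1 300
         (.node 0 (-80)
          (.node 0 (-120)
           (.leaf true [(-725, -9), (444, 529), (461, -525)] 1042366363459906446478876925248386236168580772489870651845686164514509001980681021514394133507788298648728821897905292545227118117895701926524760031399478505841922958094709754296947586095072624331842412969996334957869152630702110267883713974993698612633211414375962488907554349739948104134497136058734362266091253665759940008774852305425629296616603509806019113859309187702569470853949051142140367260947046373946637078437837245499568620849420606333465200317803313342648072776884105041790696638017489996561637466002945678980898908084500311605573549744748403809383895153554782430711467358439430722171868481484661144596281023606671676063886511001952309644372924449629219789354241792799370945497555760497271650017647514333938381607771291753491340680851569508352)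
           (.leaf true [(-689, -4), (438, 455), (475, -492)] 147821083764398504228958088277396367388420401825543703156156792456052935981027943656347381510572976880987173451263162541124596923005927212824463563537875406047607648721189943621844290844219753313135784678018621761625080457979068551577889995682166608686237545184260330467689285809634181708533298872054691446112907100291239847499227177203988758090436968869583803295640804149579798289139168411356202620479511446228994458899539209181503447557319725871255418451388906780487409162283429715448716977174637497795195578055591246500897962104533240237294776783324374428134754055152568200006466407973849662968484336127751641223698710700413053785015258343858012440962127998407540941483787065107459883762260606770745870170401127698343360461159823297401367762472666962303162496003044627411317123571513616542353598223817250032313761017786065094429452997946491784587656776212369018021953528283958508772021719134532461849049924941824987325071868343803203631577650907831141895310565102184293414288673617917075678176842234172945715230399084476081073291264))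
          (.node 1 150
           (.leaf false [(-611, 46), (600, -30), (18, 266), (-20, -272)] 15844149825580468691695045580948072936681132948146804436701726032046273839475055124900390758741921278143599786914891622628939187182862927955457774573474531211931144313285612585673325463882377271564566735234145803250616903962218509533704623532592952307180498516866208463469372885871824978066921441997554783767584623792219766919530222467316608466528044417357083798347345359532495222294720514390789280276402633946932328182680915565842608802747091224692476946412028103197170662391429892952006232286435695212699633737863499618037983344016274903235092771087590069141680480636101699621927806296072724679311053605068713629979185334304466617336459747905654399608904754934580100764566247212832373043644154604635395125306063147714532614836292260334827248829868584229370959271109494560200832387041914780075699226642061795614190248097444373605670785532695324117279032318406261458910876930973596144143719260397068373637601871221405899655284715307812639544758572485251612355408648038926100354618719771085262548788752500387224491214304412311543686436384670232121001934404193535365096989022457264402111875012663779615987131739089415948865800135382982686922468063700911368971675651844498897504879231630647647119333164978808029182121200077731454632851706759335579895552516418264871911656406896798777789416997655315734621530116556067163888149431988261764503690770333808197632)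
           (.node 2 395
            (.node 1 225
             (.leaf false [(-633, 7), (583, 13), (-10, 201), (-10, -303)] 30382973582794997187632928674181112966287020176829261667938962664621366712857205498284563571356870263076103124273691490272934854362865055884049450775644016949157596023163829810600885266623638711291437708754417318365012061937822927287989161560647585526392036289052064420628487494391012255362093956904516908252652841474988853352530431976049853763128768064477741835140911202307442201564344661921336536818193551713205381001573352745977053637527247628275821823338826358847020497679557441873597870350946415470944692978762319744801035771472507743124113812132098336388195440921416269599597155061228151075117826392062114488819752604184431843301813680184304337163840748739458827828985497235192847661159301866579921045290782640633336790096650897351154113741560471485497096661452542933307317982190265083036824841706747262146065194142320442654802515861096985132668171906052390472823238798984874872951500522330357978612226795450012051709609871301992494268628830551522575752215275495857960827290661690552454096371764409228980144067919345008610858277815660044474987544292766623123227881386617649895514051073493267777039100019083036825029965017129681335460984674471148123117824594210460629987224189775657775582912105902682267241917101060977688125514542087135497273090979517169664)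
             (.node 0 (-40)
              (.leaf true [(-660, 3), (515, 553), (489, -536)] 203375355251819725346118967551414230091054578623966778044557600327883025539635586135403211251175897997399670274048882141924600882396581507183308946037400265541092613591383067022616794796824906983346469307492423735515947579680810134804905335089599523627529304947964512654683866192772642058754492743089667146930869553267921096023469709171855000277125613390446324159298561987116072055030461533905631462664821953933888274693784544578730295734310056458506598461918782165579311027096336629064454235049500975187233280782108134566234864747475874140476887993518062456721404057519681425888514233177970144773220339482586395259490415356239977212359353335623065425437717270572750098268977718232215208262103112569442955624688411735015838276793410745825880545713287801153842495573589071348974717871811785744636464130087149215832228332850437015797574519595315885641065239291264172213547851263435037353216594952585216)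
              (.leaf false [(-622, 20), (628, -14), (11, 263), (-6, -263)] 95871760175318999024875777269570478316767236954376298152610968405512870536281899356373478422898116264887931051616020634397193563855936018897571290838109791800489297876247208719023079896906489796115823586945188381968806790740694567616751557694427762644791822845315239889681419343928002891473670449878970462959390200413595707811933899719640289826188393654240217662601091055765408514564504731563683828073660531887525769307785362175887723959295718286486626394952808758326608442428703807826582813763173137070533170797126206533399624173572520805699479988984776439143715734210699843829602494242238334784491487519907633813885755227671392069794196217437385506281875741964806069659377442525974425450136061391633540095461818044011055804524255575895321007273669508696105466764260751144011213679521796190914407325458065694621185891251235574312626272141308450113698270783166476996709851598910062627805943619404473761511221176712851645742533615474973728792161589024120858263521711784001763565916335850014985105858083942904407786177550033325073545777432061559128537960269476523934259420823488072133743244635849764283659644533229653926205530850777075497018694388981406249543695989032302363930265237665358581330151917041320088671400192721368796626944)))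
            (.leaf false [(-652, 37), (636, -20), (4, 306), (-14, -272)] 49350540670612204012131453793561930785566662263261365216727987714556278503191561774425049676651914444752809768318323595835877634479448982428696491697517990763756531236101164614913897929669685540702141584669998752526742725117792144799194398709231587611538727535657689440817650042817647350230788653666764364943693091055273995601726471748379794639554546870657577579003774167272124697356888267051271933300378183064887606641410921572645899865115356487768052312164773340295623060628940344362239183034974120944157124109888580661823260248942943390362647925010839858006755073431251271872458651825403601958341345305166055107614540661520487034791216111738605609009108308757176013094214353257739650919121940624419794781024462841424482495318439614953204266236421850488450433411856077143939761305958682649447743982502797586475283638108937690366238728792348172137823736732622578725472817394378861936411162663542312884526326358597845693805478816282463133622645376454603177676577063226089037711581297106357443281031307732970248647483314527861278387705347743284229924856490602600079754309046462394270987261457015929164731188344619978265638375477049484764799045730304))))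
         (.node 1 450
          (.node 0 (-80)
           (.leaf true [(-756, 25), (432, 433), (370, -453)] 279808090094421724677896920148616439488204059844317651390492293949426164229186526195933964317880310106264604026406153059349512696754818440261485131397912516697808361167990392153014653070725821743855596385537079146372168718235677411723938134974965578756675044097071600048318113539105835747365297114170919940729771476282177970112883659338247675323697070067757641074124376212165698883934012219978636716746373588152358505703551824049361830160191800464104156319328767973662075718258822167704765972490397038066069586236468802917969459598572122706536109713997111826329325842951380224597276431080358726042314516615106494549419135125324007077980155837180933260520614160561415939347237606906772092593739405236634004857467642623196166522473499034516075634582491793940943994880)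
           (.node 0 (-40)
            (.leaf true [(-647, 139), (506, 303), (168, -463)] 12575227066040768680279868378366732836871876524490451564409284317437500043722308644752622401073929775388056005627465195507372870159166201885502970445294707374706611824327660130951583425251013992204902360804719783138384709727889966366516851949741469428095827227465908923069402117099233650761105647058947454048572783769807677834285097493298865980057483126787261679430614393429846564864431478647370289815004781734436432020020340263013888346013074030312266630944035670086249324677573095839103808164910949237964720822285520317542779934832676256395483093563507741754287533205945952144513541682638775461654841444914048780324857932114254281652111378432221836802017284921502036558334525373455245916210766826932109320229144747774299271089841548667670057490480870068498116602689692881771611074767801595309072825275917968163313169899772392264548283986816002085126948831703787950954832428707863787774390866033400623236115025670007087393033608281703460668513034364382580169539392209883099098991954247384700106255393695786757474392934553521426865794609242473005010785740296568468496449536)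
            (.node 1 375
             (.node 2 395
              (.leaf true [(-609, 88), (602, 492), (343, -553)] 240103240270702431261972043918860935216467595060231026691655917661223358163921100236356146724619732072854696368210001807183646374066664176073121493729436589627901573408269439167659120505032665787272047095905481789684568215827086422162156592785930554425703402788949611614119166262112057782036431425243781833508818535517478467429361753064039311931559110990810403644114687111461165679733376578259443728938826122195363730463474513856007474391290916295430838022154486421015915751083244770066430901588743386530089004547208986067943393653766779409246441654479909303156408135749249713921344394764518095575838858453005812824318586116293874076596387221009667690944685742028312991009909038281950950355927181897199073115535510157918742255885138628149119399350835451440173794726019473283545421470256199147386711904227609961011378376787101885825604551547285493187780435108531543929241724390367385868826436871923405362366368227744808960)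
              (.leaf false [(-667, -16), (634, 26), (-17, 258), (3, -289)] 20457642173477377379601696156026751076874850465357184055091427168720715107488061474889137410970943580521589453283721007973480729019833979399473008938744950451471074598417187371356844221522172584271290214398126393261251541592797654911592627856455552366453738548535460129071992680011439268525950316763665090729929138807506802093695604129031312944744409331277919641869603446711548431651907809244169588268320397917033121231129274734218136458284069437777382445411101912078601644780660170406883270006628842458550391445363373038278652960387676373988885892539802648938277991175672916149398083099308179071544022055786143750209125237015844508807276026416739741271505363443676511524525750172597035379283171229715823273690355906232408618941447011339361362209778316067292700108209541248823619362431895103298646872466569216307328027352405690427587001872617361369127472455416025009840799448465523836619484786564488238248616182411034591358138418058491348189609622495787616569175780117010277639325892846596954148553871476857774581098367640093723135627686288898147061463545559352067590455296))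
             (.leaf true [(-588, 245), (592, 233), (-53, -813)] 121582838296752560802716141439711914758072483709100703017449881987525218920657342666260590926263251194464891356177661977298792798287919422695036292512361104543741403306137659771842404368531390884219589872941404931022019661603947770604645413759033557641865854957852007569027755376186452999427460832710894281090557030310221358538647807664835096668340999553004897263360601672038621451166479620093213480280428397684101424600267962280027294398666405656264968384422717951195811165704712445770177877646626448793047733387550647217858394908041286919659135758546374383694171181643405820225191965613708954684035122767160511707540728871241377917002537023806725177401671680))))
          .empty))
        (.node 1 300
         (.leaf false [(-713, 84), (671, -49), (9, 277), (-35, -277)] 5876921798545610921987893072319079391506403839063485861845994800618335632250467975552653160564230112614256591941072493796600548764854807644921453636294388199594489488772598425356197065125217711015769802641233132231874249478191121917725203220676334060833979689177901793983512034537553285800297327989615068308446925784627251511537376425365588450869866357178572009048738444836188784191252304794646537537324340306506442479983817990200805839677042151676557690322100431821639019548875582980827190526678145358713934293421325877637381471449221899870012906793587643131261532196580815097476710926513056015765278926171878770627869850501923786792697415116914139220569958190984980572769895973075142418406835647896515694460887098320070621562910640832764239842370119444188396314434167367038783787956369614726232904087129158002478456073782984562060657114111282127817322998026105130246368712794341501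80670285494760085826041258169779829539636769354702089268985727206980309069516798089573873148209551153300141940849113415124263841604270096330374251794335284448336943345215721090453112284072327621145074662138846905371280336759573279643919608696972213817376300194636572298773558080568803914312676172686227654922779924833036705951722219453187760928928099523249108929103300027010815743800757336836904404910080)
         (.node 2 435
          (.node 0 (-80)
           (.node 1 450
            (.leaf false [(-758, -7), (628, 14), (-24, 249), (-19, -255)] 283906817131715191454578663899068366078652057092543177816159324776245179099382540063250919063237819281058152198487790787766745987382385277131343812961835453196534363208383099448940059348825663848212519692519254430549575248490416401540721631755856153763175365780865580011411568038723836229287450283542614375639274750212167145125297196664509543943999565097586640468762158350338976973187491294796089287325291483253851337943138129407662169457079803319891033881535158931013478134250496611801255116480688756147659609198955253650636471292175037429118734684485557708327803701796558071707466730425052476585822453381063121137198922053115125647840835816255448428956257097899287221402040592689217451620140398435733873457498636945264504717726256735878322453845861435269553213273877108289747264517716831289872397309460796943446672159788784058242017207918056231313075088822957400318510433924363886548030370946254829831381894235408921962598196417990669005502952712647371472616227192011499636075499289578212267180736614189157289590213043698515643305908267963863798133030912)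
            (.leaf true [(-764, 258), (584, 354), (-59, -478)] 115260654948155745197950899767035297778460178065160566599825283390207472300921493288875811340936257331530551623651455942259030134455897937767824889038563758881173300355812210605511418537179608569480917714511250311524854560256550991932444151228228519555364563266486798683890443284425731926517490506221649516106014568351697962403062054729823648063512766561069035626085832033184219296307726694987192540174970252785189529305872394869116790602716880342655143119791732293300885106264423773439090772693953485095590863230845909418515418226015450784523548097926515212670932742234316730331295266541331620432898546982936178364764373839252485880938496))
           (.node 1 450
            (.leaf false [(-689, 69), (705, -73), (36, 289), (-24, -255)] 2161088651729009671593284035914523783427073776924330670196615226711520757709587724166145436377646152692156393405522891814828872256559861992393388410851029534932507681672848532526225621589732887239730133711198712999644842834846648206119819967977210169580259420904359315055375404697808332197220674763822869182563347122752405897488635819059985141146809017749515927904701639079717366543589280556407772359406286248519936095033261194076891097511581832051104213674511772788184718020164633552559607928644399550517500301380416159268620175653566447501514510713801698906026630744803832498838594758712074831035759338996776748858749420246749070398332783644449015338519570628936663947950617486765490529467097950086354522208864515528974567559389391068385638153844866026550590273382015762943476670779752253180914905274864772640773618181257943767349552103119848989175339721793533925814812363831022456086313722425798533028986814375800261431438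684506339037438001161523271374836497291326401113350421463438687180684718450662286864858211915229092016733942110923528122771330082249050998473242855598114402989978282513762615296)
            (.leaf true [(-696, 231), (586, 344), (79, -601)] 102984669858041339110258540556187165862463119326664044744258725835357532775870409449042476955346619372113696556347556659646672199047510709293905031603901623926347726708358457900949587992016950917846506789827779662692401050937481044852606163795487925605254368405828237805519331729788041039736041060774506359828342276484634523918843147525576116113980629334040727911792267848885993365396865849666753478231906785063985257179904774155774438719792662020794272325268342534187925629534756505119492609692633939010724328138000943264872030562270517829546489147239454711626295790029679346356647050225774536103606982660926049526046171029608080668098560)))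
          (.leaf false [(-771, 60), (720, -38), (5, 224), (-29, -274)] 13247434888762332783161536331017726754604952634013557318334054823617403716086988686337408349180831318414452314245251660894995294689847496361538677555465095051301284059238344265250764418872938759290956604560723873521246183130485469719153262416911597572643453495679933485297265099661673208221935177418912362941911388170666313020937000581520179371783407960913217800754986172961051407765823481087278081699362249978602916465373014999595031042237112717376643076393299531151012546804572048813644158698830672587582729804408640236037833580106586267462917567905008885953244311176665114179699493280728640324435287855422451128704099424932875196960251593483794939540018342842577504899155912354275067084628286188048723840108682584879968840375350741441590690232809871697647763203496860032340757060069790827540125611976514239446719095751051209318511559014577268867343455155228285661565371078577694542779698952549079020702252298896769587910518230960015583131411271394740817840514796708865643519105521433363069885096004595620702362742178998659952114650527374083245987705382352121623128191421495658643170806089423992129978724894107548872159412034625444556480076601242060587008))))))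
     (.node 2 525
      (.node 2 490
       (.node 0 (-160)
        (.node 2 470
         (.node 1 300
          (.leaf false [(-866, -44), (557, 50), (-103, 248), (-33, -265)] 155722848746262009010846362354181257036608524568988428016083345502672135024182476313858969607166187961856001570699728445475367861121660717870318590171308977426392335012653898840845777372523225319961937230747156061522380878748209798575671839015499721456728000631728594782695322069876837457683626052290568694421683979381972378695360242131151966147372257323193357127891320513780273593073620521955401323523591615651460597216994466331914792366328658375060858332795372124237857486033352194980377768458005540639412609463899649275374503492900006511697530467824063374170109663330618408825657022096990568864972299794807357060578512006902669793837354040376825712640654074647555646608318500781863774957503576660844771483891107423875773561932524935228284153995350205235030431545547670919930151156365055505643287184483471842968137184626353535103280837617442076519570865656987501905752547859913041319279908453272783246077114766109647096758104871242140264258738603942621620236110802539400961504273142146434508854503062848189184452612722399056723144947042002711156873098848882399668526210719234171525963065148809130619932465640897511424)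
          (.node 0 (-240)
           (.leaf true [(-886, 43), (386, 476), (324, -600)] 12252957717342913187643779605402359852641329775753063680881504940973718054879007367706724577202219612998417847689482440172119102716485574334788937970469093073778148277209687787189454726043890209315823340888677590516649372823723367037365623579746062539991886742121441878036584310572634144937515232397083976903375742859671826257333879706668307881983093092169566144484735849146295737059284251058380876603555659331548734992913144220248690680941850363182170142868966096296948260972981657372694075677757896354019449137258024248273047279836055416167621452476742250935929075533719574579385012682613585418170445711055830017186555492163232227991879431648955644614436308039479911512220281375281814888557531170026205831357439934464)
           (.leaf true [(-831, 70), (447, 440), (342, -612)] 1065163164414156767640429051549065211285179329795036025050778304531681287164188461036570139871348284513023866883346897348638001158716820384577075193018719909647491850936380557680843484324958650598262696528267271941798996948787998492872112086122137676310423617026698620615725827595692527884493981419193314462254118615648856241605542161103135116399396930537938757267321307549681678316138124519327168385487307257527152777016828198699652864226469614948651992242960019637114785664343772759021573250946511219341803273707774246545945084874130766382768063148538722532785578511758971432666254014561380775739302612260137775774810799803528319763199524580469390598664574765510236966085476359657115826973123073916674525640901076035204116038164959544766171220770922608513083234762312546689910593736298266585317748254544947375955689187349315844881181243334754102847256404144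5686792116769598935323562282756538136724807168476504965697859165909411145680208895778622554223715386333238007347200471245967028918614602554947430297812525393997035814476987598281750113079525376)))
         (.leaf false [(-908, -97), (615, 98), (-68, 165), (-18, -278)] 357149724732202809942583630690170099719153625916270727083237189475507574684338864978902066937223632370532452737793109570185512825270412823144454366487323006643647773790757500307283656277049149099535421453621249988690030400753150418622532202109621531366862658360011926158755096999678891417717871664394302385646355795361925645370326928262865470819144023313829464412038074661953847758959710790612286308266841435437269819496296895121162234330564940754168239575886234909463359244780957745172954689354516271701777925020409218352221245848974422060531537355309133668020076790374819269717656351113282562817379760044992897530426769202185237795726127177623368854678725374932601287566740687156197393721640075457656016671644026414272925842845947757768410358147802667332437680808156438799253778103418631494438687383292016866119692885664225073680046318595365126556242610416073492980910384282940328896906399213551579137770271986552407094694663263918491971877202404433736465696506575733030003477243998507699352855753345190779225868393464138665082674374273134097788870692509976119403707314608695600511949944889755821336791508794056976790200169718936009190311136967082638087199242680511649576895264989545620978317163946032576425543581319561216))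
        (.leaf false [(-804, 3), (712, 30), (-22, 263), (-12, -291)] 954578285258319200807088898367177542705081588979011287133775158526727052804945440782625705186954572917399483516554373111864671509564795985758472530458195666809766277240099861660394994563778596004097967808716597226221498563521880663814603447563816647312492942635747082253262750296361118578856159207308129153357077163139949108889029686227486882213848512713859770121208626414482048153317628983741263479605506059557496166164996270588268086251482686093122403838055155729586027010242169439668032869673314046407681135327615350107200941706145764137979362343093048668873369915931406148430154011601189390472247859025304521331775877520050538943380269161532162526619904102470674858364140892336016211251169525768580518293929783632449967028392581468718672002984236142853386382586893369575215466869569095991145413690799932201768038624002636330428255122161021244319325034585361618457667867809494981229075050419302507474062902630892866335869984711434057491026828404861519352589467811410226906219122369852861744355256469202014808635881455485365046833796835144194647993066762780581078166387632228464294014638512825701571230817262437344343992623929822238971348619552340357883907614720913309696))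
       (.leaf false [(-919, -48), (725, 61), (-45, 222), (-17, -296)] 5776081483722020498096355872126656220728777037632745817370981239545278264380899180944863499533625193820542495186802212982042212674436067411356528856050109682915080469181682271549140755489049476174584905153110389494810221168965320609227152106205855507390190127016811516948474736956391454669691147646968253794297587997445205928941408079998083144421751228192693941822469863623432356071484456727201512381415675513759064840040208698492008178616202329467271976089135700936998206294179844510146092061299401808208813451686076800720101772181881630795424209283258319090945942061712524379280505278624759617474901308438419347923919900732467326841694280494144596995309806846008272597745447810484404450805841491058964083192512391534438832048252385562144357605857694756089882186428557017579866442880002214761295477613100812825994548837835877918758609358425525339823845486840692627209503510951515004649057934901042084675508197729658226836467362865580148414678202977236183926643666140455390671276785755339978538137389886328811369732063059475760750231317133267772112896))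
      (.leaf false [(-962, 4), (794, 24), (-29, 256), (-29, -306)] 79125433729101578045123376411534873013811119917163592620532502409934594814856545941052736379494481281939627298002352414253574328450556772911370550608708906093647367217226742681152682709215486470452137070256063091046723628520981434638525275583466207947263082749541444425921373426569804043227843373122629668982421471734617746409600999705167973102727145661336115371977211852176067219684180359361943691813682284205376202900071710410063110865277331105590877650746907040035762128981070366272096532513549404505921072399879934933135904511258569619074389047085972413019354823416917043516417880582829982339067394928643035477372502004438947664759273185912084574449856327167545325464189918716387337549755082999332701576889386214345494519176500528640819674973582489467243144302294828718526684652656195445313685376622998723755197305002993452768754225890134538323715162112))))))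

theorem confA : check (discO 575 :: (slabO ((1000 : ℕ) : ℤ) ++ [beeO])) [(-1030, 31), (1026, -44), (11, 359), (-14, -339)]
    7938669365154591668211476855828542845442588766993154861239894261573066855977878541106855194608257982780199599300261821568452610418230937230048856563102306385809704389172410279818680743284653616302429589938738198625852028920502059403630695915887430464368488569835290649679885949477699043387166056338090279794116160835198570598791551573592716785947483990347467711750783663549321099108258247533970731714686824327453765859340954631885841959502110773078291795208398274525128430799937113090820263472915695500363050840469401015226374542465484316426611089269210836334152320728551949812142192853571996759291180207065612317534878528078313143331844826751804889223518028649599845046143860780203804719972974933701484012792780581212654634757928966177591754047848690135234146843593514360254056444925286701401230308679232400316861102686208 = true := by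
  decide +kernel

theorem confB : check (discO 1000 :: slabO ((1085 : ℕ) : ℤ)) [(-1009, 17), (1007, 18), (0, -2)]
    1959245747887773831643820639178900531465437169750238592998312435874637894364917120178975540871698885018216410352558477229146399595293518841476378541041697414071092349875125355552009119925551381724915485148114990793582863746647164930226967883154019268969197886453191806107453967681457376846925078223498471647306555244424708361842205292515416671304666399764090203468105728547410356222123812537915904835407280192862883058832484693235226729524937395054252537304354763333481059496658409127667529211865984504678219065593600346345469721608327818207033888089438927780094439914366447367408444640266901657807166286865578230629722295061627688576768462944137698341530963933430939315644457044331946255486826679439348796935316557860077282778894358452958425971042256064183686914020253049795724370584521914561774205425032654612701947089957019433110509853611872358195532503275356173706555398673578569316719456999999045787796440800142281421110333281983084635819842167524734850011201702236039280352126571086867852656557147815936 = true := by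
  decide +kernel

theorem triTree_ok : checkTT triTree 0 60 0 100 = true := by decide +kernel

theorem slabTree_ok : checkST slabTree (-1250) 0 0 600 0 600 = true := by decide +kernel

end Danzer

namespace Danzer

theorem Pierce.mono {H K : ℂ → ℝ → Prop} (hK : Pierce K) (h : ∀ c ρ, H c ρ → K c ρ) : Pierce H := by
  rcases hK with ⟨pts, h1, h2⟩ | ⟨pts, h1, h2⟩
  · exact Or.inl ⟨pts, h1, fun c ρ hr hh => h2 c ρ hr (h c ρ hh)⟩
  · exact Or.inr ⟨pts, h1, fun c ρ hh => h2 c ρ (h c ρ hh)⟩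

/-- transfer along an isometry fixing the origin -/
theorem Pierce.isom {H K : ℂ → ℝ → Prop} (e : ℂ ≃ₗᵢ[ℝ] ℂ) (hK : Pierce K) (h : ∀ c ρ, H c ρ → K (e c) ρ) :
    Pierce H := by
  have key : ∀ c p, ‖c - e.symm p‖ = ‖e c - p‖ := by
    intro c p
    rw [← e.norm_map (c - e.symm p), map_sub, e.apply_symm_apply]
  rcases hK with ⟨pts, h1, h2⟩ | ⟨pts, h1, h2⟩
  · refine Or.inl ⟨pts.map e.symm, by simpa using h1, fun c ρ hr hh => ?_⟩
    obtain ⟨p, p1, p2⟩ := h2 _ ρ hr (h c ρ hh)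
    exact ⟨e.symm p, List.mem_map_of_mem p1, by rw [key]; exact p2⟩
  · refine Or.inr ⟨pts.map e.symm, by simpa using h1, fun c ρ hh => ?_⟩
    obtain ⟨p, p1, p2⟩ := h2 _ ρ (h c ρ hh)
    exact ⟨e.symm p, List.mem_map_of_mem p1, by rw [key]; exact p2⟩

/-- the reflection in the imaginary axis -/
noncomputable def mirX : ℂ ≃ₗᵢ[ℝ] ℂ := Complex.conjLIE.trans (LinearIsometryEquiv.neg ℝ)

theorem mirX_re (c : ℂ) : (mirX c).re = -c.re := by simp [mirX]
theorem mirX_im (c : ℂ) : (mirX c).im = c.im := by simp [mirX]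
theorem conjLIE_re (c : ℂ) : (Complex.conjLIE c).re = c.re := by simp
theorem conjLIE_im (c : ℂ) : (Complex.conjLIE c).im = -c.im := by simp

theorem Slab.isom {a ρ : ℝ} {c : ℂ} (e : ℂ ≃ₗᵢ[ℝ] ℂ) (h1 : |(e c).re| = |c.re|) (h2 : |(e c).im| = |c.im|)
    (h : Slab a c ρ) : Slab a (e c) ρ := by
  unfold Slab at *
  rw [h1, h2, e.norm_map]
  exact h

theorem SlabHyp.isom {o c : ℂ} {g ρ : ℝ} (e : ℂ ≃ₗᵢ[ℝ] ℂ) (h1 : |(e c).re| = |c.re|) (h2 : |(e c).im| = |c.im|)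
    (h : SlabHyp o g c ρ) : SlabHyp (e o) g (e c) ρ := by
  obtain ⟨a1, a2, a3, a4, a5⟩ := h
  refine ⟨a1, a2, ?_, ?_, a5.isom e h1 h2⟩
  · rw [← map_sub, e.norm_map]; exact a3
  · rw [e.norm_map]; exact a4

theorem slab_quadrant (o : ℂ) (g : ℝ) (hg : 0 ≤ g) (hg6 : g ≤ 575) (ho : Slab 1000 o g) (hx : o.re ≤ 0) (hy : 0 ≤ o.im) :
    Pierce (SlabHyp o g) := by
  have ho' := ho
  obtain ⟨L, l1, l2, -⟩ := ho'
  rw [norm_sq_c] at l1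
  have := le_abs_self o.im
  refine checkST_sound o g hg ho slabTree _ _ _ _ _ _ slabTree_ok ?_ ?_ ?_ ?_ ?_ ?_
  · push_cast; nlinarith
  · push_cast; exact hx
  · push_cast; exact hy
  · push_cast; nlinarith
  · push_cast; exact hg
  · push_cast; linarith

theorem slab_pierce (o : ℂ) (g : ℝ) (hg : 0 ≤ g) (ho : Slab 1000 o g) : Pierce (SlabHyp o g) := by
  rcases le_total 575 g with hg6 | hg6
  · refine Pierce.mk4 [(-1030, 31), (1026, -44), (11, 359), (-14, -339)] (by simp) fun c ρ hh => ?_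
    obtain ⟨a1, a2, a3, a4, a5⟩ := hh
    refine check_sound _ _ _ confA c ρ a1 fun q hq => ?_
    rw [List.mem_cons, List.mem_append, List.mem_singleton] at hq
    rcases hq with rfl | hq | rfl
    · exact discO_valid _ _ _ (by push_cast; linarith)
    · exact slabO_valid 1000 c ρ (by push_cast; exact a5) q hq
    · exact beeO_valid c ρ a1 a4
  · have half : ∀ o : ℂ, Slab 1000 o g → o.re ≤ 0 → Pierce (SlabHyp o g) := by
      intro o ho hx
      rcases le_total 0 o.im with hy | hy
      · exact slab_quadrant o g hg hg6 ho hx hy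
      · refine Pierce.isom Complex.conjLIE (slab_quadrant (Complex.conjLIE o) g hg hg6 ?_ ?_ ?_) ?_
        · exact ho.isom _ (by rw [conjLIE_re]) (by rw [conjLIE_im, abs_neg])
        · rw [conjLIE_re]; exact hx
        · rw [conjLIE_im]; linarith
        · intro c ρ h
          exact h.isom _ (by rw [conjLIE_re]) (by rw [conjLIE_im, abs_neg])
    rcases le_total o.re 0 with hx | hx
    · exact half o ho hx
    · refine Pierce.isom mirX (half (mirX o) ?_ ?_) ?_
      · exact ho.isom _ (by rw [mirX_re, abs_neg]) (by rw [mirX_im])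
      · rw [mirX_re]; linarith
      · intro c ρ h
        exact h.isom _ (by rw [mirX_re, abs_neg]) (by rw [mirX_im])

theorem slab_pierceB : Pierce (fun c ρ => Slab 1085 c ρ) := by
  refine Pierce.mk3 [(-1009, 17), (1007, 18), (0, -2)] (by simp) fun c ρ hr hh => ?_
  refine check_sound _ _ _ confB c ρ (by linarith) fun q hq => ?_
  rw [List.mem_cons] at hq
  rcases hq with rfl | hq
  · exact discO_valid _ _ _ (by push_cast; linarith)
  · exact slabO_valid 1085 c ρ (by push_cast; exact hh) q hq

/-- unit vectors parametrized by the tangent of the half angle -/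
theorem slab_of (t₁ t₃ : ℝ) (h1 : 0 ≤ t₁) (h13 : t₁ ≤ t₃) (hs : 100 * (t₁ + t₃) ≤ 38 * (1 - t₁ * t₃))
    (a : ℝ) (c : ℂ) (ρ : ℝ)
    (k1 : (1 + t₁ ^ 2) * (‖c‖ ^ 2 + a ^ 2) - 2 * a * (-(2 * t₁ * c.re) + (1 - t₁ ^ 2) * c.im) ≤ (1 + t₁ ^ 2) * (ρ + 1000) ^ 2)
    (k2 : ‖c‖ ^ 2 + a ^ 2 + 2 * a * c.im ≤ (ρ + 1000) ^ 2)
    (k3 : (1 + t₃ ^ 2) * (‖c‖ ^ 2 + a ^ 2) - 2 * a * (2 * t₃ * c.re + (1 - t₃ ^ 2) * c.im) ≤ (1 + t₃ ^ 2) * (ρ + 1000) ^ 2) :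
    Slab a c ρ := by
  have h3 : 0 ≤ t₃ := h1.trans h13
  have hp := mul_nonneg h1 h3
  rcases le_total 0 c.im with hy | hy
  · refine ⟨c.im, by linarith, ?_, fun _ => ?_⟩
    · rw [abs_of_nonneg hy]; linarith
    · rw [abs_of_nonneg hy]
  · rw [Slab, abs_of_nonpos hy]
    obtain ⟨x, y⟩ := c
    simp only at *
    obtain ⟨Y, rfl⟩ : ∃ Y, y = -Y := ⟨-y, by ring⟩
    have hY : 0 ≤ Y := by linarith
    set N := ‖(⟨x, -Y⟩ : ℂ)‖ ^ 2
    have d1 : 0 < 1 + t₁ ^ 2 := by positivity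
    have d3 : 0 < 1 + t₃ ^ 2 := by positivity
    set l₁ := (2 * t₁ * x + (1 - t₁ ^ 2) * Y) / (1 + t₁ ^ 2) with hl1
    set l₃ := (-(2 * t₃ * x) + (1 - t₃ ^ 2) * Y) / (1 + t₃ ^ 2) with hl3
    have e1 : l₁ * (1 + t₁ ^ 2) = 2 * t₁ * x + (1 - t₁ ^ 2) * Y := by rw [hl1]; field_simp
    have e3 : l₃ * (1 + t₃ ^ 2) = -(2 * t₃ * x) + (1 - t₃ ^ 2) * Y := by rw [hl3]; field_simp
    have f1 : N + 2 * a * l₁ + a ^ 2 ≤ (ρ + 1000) ^ 2 := by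
      refine le_of_mul_le_mul_left ?_ d1
      have : (1 + t₁ ^ 2) * (N + 2 * a * l₁ + a ^ 2) = (1 + t₁ ^ 2) * (N + a ^ 2) + 2 * a * (l₁ * (1 + t₁ ^ 2)) := by ring
      rw [this, e1]; linarith
    have f3 : N + 2 * a * l₃ + a ^ 2 ≤ (ρ + 1000) ^ 2 := by
      refine le_of_mul_le_mul_left ?_ d3
      have : (1 + t₃ ^ 2) * (N + 2 * a * l₃ + a ^ 2) = (1 + t₃ ^ 2) * (N + a ^ 2) + 2 * a * (l₃ * (1 + t₃ ^ 2)) := by ring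
      rw [this, e3]; linarith
    refine ⟨max l₁ l₃, ?_, ?_, ?_⟩
    · rcases max_choice l₁ l₃ with h | h <;> rw [h] <;> assumption
    · have m1 := le_max_left l₁ l₃
      have m3 := le_max_right l₁ l₃
      set M := max l₁ l₃
      rcases eq_or_lt_of_le h3 with z | z
      · have z1 : t₁ = 0 := by linarith
        rw [z1] at e1
        nlinarith
      · have n1 := mul_le_mul_of_nonneg_left m1 (mul_nonneg h3 d1.le)
        have n3 := mul_le_mul_of_nonneg_left m3 (mul_nonneg h1 d3.le)
        have id : t₃ * (1 + t₁ ^ 2) * l₁ + t₁ * (1 + t₃ ^ 2) * l₃ = (t₁ + t₃) * ((1 - t₁ * t₃) * Y) := by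
          have : t₃ * (1 + t₁ ^ 2) * l₁ + t₁ * (1 + t₃ ^ 2) * l₃ = t₃ * (l₁ * (1 + t₁ ^ 2)) + t₁ * (l₃ * (1 + t₃ ^ 2)) := by ring
          rw [this, e1, e3]; ring
        have id2 : t₃ * (1 + t₁ ^ 2) * M + t₁ * (1 + t₃ ^ 2) * M = (t₁ + t₃) * ((1 + t₁ * t₃) * M) := by ring
        have q : (1 - t₁ * t₃) * Y ≤ (1 + t₁ * t₃) * M := by
          refine le_of_mul_le_mul_left ?_ (show 0 < t₁ + t₃ by linarith)
          linarith
        have pb : 1934 * (t₁ * t₃) ≤ 66 := by nlinarith [sq_nonneg (t₁ - t₃)]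
        have r1 : 934 * (1 + t₁ * t₃) * Y ≤ 1000 * ((1 - t₁ * t₃) * Y) := by nlinarith
        have r2 : (1 + t₁ * t₃) * (934 * Y) ≤ (1 + t₁ * t₃) * (1000 * M) := by linarith
        have := le_of_mul_le_mul_left r2 (by linarith)
        linarith
    · intro hx
      have b3 : 100 * t₃ ≤ 38 := by linarith
      have b1 : 100 * t₁ ≤ 38 := by linarith
      rcases le_total 0 x with h | h
      · rw [abs_of_nonneg h] at hx
        refine le_trans ?_ (le_max_left _ _)
        refine le_of_mul_le_mul_right ?_ d1
        rw [e1]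
        have : t₁ * Y ≤ x := by nlinarith
        nlinarith
      · rw [abs_of_nonpos h] at hx
        refine le_trans ?_ (le_max_right _ _)
        refine le_of_mul_le_mul_right ?_ d3
        rw [e3]
        have : t₃ * Y ≤ -x := by nlinarith
        nlinarith

end Danzer

namespace Danzer

/-- the disk `(c, ρ)` is not far from the disks of radius 1000 in direction `u` -/
def Far (b : ℝ) (u c : ℂ) (ρ : ℝ) : Prop := ∀ a : ℝ, 0 ≤ a → a ≤ 1000 + b → ‖c - a • u‖ ≤ ρ + 1000

/-- everything known about a disk -/
def Hyp (u₁ u₂ u₃ : ℂ) (b : ℝ) (o : ℂ) (g : ℝ) (c : ℂ) (ρ : ℝ) : Prop :=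
  0 ≤ ρ ∧ g ≤ ρ ∧ ‖c - o‖ ≤ ρ + g ∧ (ρ ≤ 1000 → ‖c‖ ≤ ρ + b) ∧ Far b u₁ c ρ ∧ Far b u₂ c ρ ∧ Far b u₃ c ρ

theorem Far.isom {b ρ : ℝ} {u c : ℂ} (e : ℂ ≃ₗᵢ[ℝ] ℂ) (h : Far b u c ρ) : Far b (e u) (e c) ρ := by
  intro a h0 h1
  have : e c - a • e u = e (c - a • u) := by rw [map_sub, map_smul]
  rw [this, e.norm_map]
  exact h a h0 h1

theorem Hyp.isom {u₁ u₂ u₃ o c : ℂ} {b g ρ : ℝ} (e : ℂ ≃ₗᵢ[ℝ] ℂ) (h : Hyp u₁ u₂ u₃ b o g c ρ) :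
    Hyp (e u₁) (e u₂) (e u₃) b (e o) g (e c) ρ := by
  obtain ⟨a1, a2, a3, a4, a5, a6, a7⟩ := h
  refine ⟨a1, a2, ?_, ?_, a5.isom e, a6.isom e, a7.isom e⟩
  · rw [← map_sub, e.norm_map]; exact a3
  · rw [e.norm_map]; exact a4

/-- the quadratic inequality behind `Far` -/
theorem Far.quad {b ρ : ℝ} {u c : ℂ} (h : Far b u c ρ) (a : ℝ) (h0 : 0 ≤ a) (h1 : a ≤ 1000 + b) (hu : ‖u‖ = 1) :
    ‖c‖ ^ 2 + a ^ 2 - 2 * a * (u.re * c.re + u.im * c.im) ≤ (ρ + 1000) ^ 2 := by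
  have h2 := pow_le_pow_left₀ (norm_nonneg _) (h a h0 h1) 2
  have hu2 : u.re ^ 2 + u.im ^ 2 = 1 := by rw [← norm_sq_c, hu]; norm_num
  rw [norm_sq_c] at h2 ⊢
  simp only [Complex.sub_re, Complex.sub_im, Complex.real_smul, Complex.re_ofReal_mul, Complex.im_ofReal_mul] at h2
  have : (c.re - a * u.re) ^ 2 + (c.im - a * u.im) ^ 2
    = c.re ^ 2 + c.im ^ 2 + a ^ 2 * (u.re ^ 2 + u.im ^ 2) - 2 * a * (u.re * c.re + u.im * c.im) := by ring
  rw [this, hu2] at h2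
  linarith

theorem stage_t (u₁ u₃ : ℂ) (t₁ t₃ : ℝ) (n1 : ‖u₁‖ = 1) (n3 : ‖u₃‖ = 1) (h1 : 0 ≤ t₁) (h13 : t₁ ≤ t₃)
    (ht : 2 * (t₁ * t₃) + t₃ ^ 2 ≤ 1)
    (e1 : (1 + t₁ ^ 2) * u₁.re = -(2 * t₁)) (f1 : (1 + t₁ ^ 2) * u₁.im = 1 - t₁ ^ 2)
    (e3 : (1 + t₃ ^ 2) * u₃.re = 2 * t₃) (f3 : (1 + t₃ ^ 2) * u₃.im = 1 - t₃ ^ 2)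
    (b : ℝ) (hb : 0 ≤ b) (o : ℂ) (g : ℝ) (hg : 0 ≤ g)
    (o1 : Far b u₁ o g) (o2 : Far b (-Complex.I) o g) (o3 : Far b u₃ o g) :
    Pierce (Hyp u₁ (-Complex.I) u₃ b o g) := by
  have h3 : 0 ≤ t₃ := h1.trans h13
  have q1 : ∀ c ρ a, Far b u₁ c ρ → 0 ≤ a → a ≤ 1000 + b →
      (1 + t₁ ^ 2) * (‖c‖ ^ 2 + a ^ 2) - 2 * a * (-(2 * t₁ * c.re) + (1 - t₁ ^ 2) * c.im) ≤ (1 + t₁ ^ 2) * (ρ + 1000) ^ 2 := by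
    intro c ρ a h h0 ha
    have := mul_le_mul_of_nonneg_left (h.quad a h0 ha n1) (show 0 ≤ 1 + t₁ ^ 2 by positivity)
    have e : (1 + t₁ ^ 2) * (‖c‖ ^ 2 + a ^ 2 - 2 * a * (u₁.re * c.re + u₁.im * c.im))
      = (1 + t₁ ^ 2) * (‖c‖ ^ 2 + a ^ 2) - 2 * a * (((1 + t₁ ^ 2) * u₁.re) * c.re + ((1 + t₁ ^ 2) * u₁.im) * c.im) := by ring
    rw [e, e1, f1] at this
    linarith
  have q3 : ∀ c ρ a, Far b u₃ c ρ → 0 ≤ a → a ≤ 1000 + b →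
      (1 + t₃ ^ 2) * (‖c‖ ^ 2 + a ^ 2) - 2 * a * (2 * t₃ * c.re + (1 - t₃ ^ 2) * c.im) ≤ (1 + t₃ ^ 2) * (ρ + 1000) ^ 2 := by
    intro c ρ a h h0 ha
    have := mul_le_mul_of_nonneg_left (h.quad a h0 ha n3) (show 0 ≤ 1 + t₃ ^ 2 by positivity)
    have e : (1 + t₃ ^ 2) * (‖c‖ ^ 2 + a ^ 2 - 2 * a * (u₃.re * c.re + u₃.im * c.im))
      = (1 + t₃ ^ 2) * (‖c‖ ^ 2 + a ^ 2) - 2 * a * (((1 + t₃ ^ 2) * u₃.re) * c.re + ((1 + t₃ ^ 2) * u₃.im) * c.im) := by ring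
    rw [e, e3, f3] at this
    linarith
  have q2 : ∀ c ρ a, Far b (-Complex.I) c ρ → 0 ≤ a → a ≤ 1000 + b →
      ‖c‖ ^ 2 + a ^ 2 + 2 * a * c.im ≤ (ρ + 1000) ^ 2 := by
    intro c ρ a h h0 ha
    have := h.quad a h0 ha (by simp)
    simp only [Complex.neg_re, Complex.neg_im, Complex.I_re, Complex.I_im] at this
    linarith
  rcases le_or_gt (100 * (t₁ + t₃)) (38 * (1 - t₁ * t₃)) with hs | hs
  · have sl : ∀ a, 0 ≤ a → a ≤ 1000 + b → ∀ c ρ, Far b u₁ c ρ → Far b (-Complex.I) c ρ → Far b u₃ c ρ → Slab a c ρ := by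
      intro a h0 ha c ρ k1 k2 k3
      exact slab_of t₁ t₃ h1 h13 hs a c ρ (q1 c ρ a k1 h0 ha) (q2 c ρ a k2 h0 ha) (q3 c ρ a k3 h0 ha)
    rcases le_total b 85 with hb' | hb'
    · refine (slab_pierce o g hg (sl 1000 (by norm_num) (by linarith) o g o1 o2 o3)).mono ?_
      rintro c ρ ⟨a1, a2, a3, a4, a5, a6, a7⟩
      refine ⟨a1, a2, a3, fun hr => ?_, sl 1000 (by norm_num) (by linarith) c ρ a5 a6 a7⟩
      linarith [a4 hr]
    · refine slab_pierceB.mono ?_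
      rintro c ρ ⟨a1, a2, a3, a4, a5, a6, a7⟩
      exact sl 1085 (by norm_num) (by linarith) c ρ a5 a6 a7
  · have h33 := mul_nonneg h1 h3
    obtain ⟨pts, p1, p2⟩ := checkTT_sound (100 * t₁) (100 * t₃) (by linarith) (by nlinarith) (by nlinarith) triTree
      0 60 0 100 triTree_ok (by push_cast; linarith) (by push_cast; nlinarith) (by push_cast; linarith) (by push_cast; nlinarith)
    refine Pierce.mk3 pts p1 ?_
    rintro c ρ hr ⟨a1, a2, a3, a4, a5, a6, a7⟩
    refine p2 c ρ hr ⟨?_, ?_, ?_⟩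
    · have := q2 c ρ 1000 a6 (by norm_num) (by linarith)
      nlinarith
    · have := q1 c ρ 1000 a5 (by norm_num) (by linarith)
      nlinarith
    · have := q3 c ρ 1000 a7 (by norm_num) (by linarith)
      nlinarith

theorem stage_ord (u₁ u₃ : ℂ) (n1 : ‖u₁‖ = 1) (n3 : ‖u₃‖ = 1) (x1 : u₁.re ≤ 0) (x3 : 0 ≤ u₃.re)
    (y1 : 0 ≤ u₁.im) (y3 : 0 ≤ u₃.im) (hl : u₃.im ≤ u₁.im)
    (hd : -u₃.im ≤ u₁.re * u₃.re + u₁.im * u₃.im)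
    (b : ℝ) (hb : 0 ≤ b) (o : ℂ) (g : ℝ) (hg : 0 ≤ g)
    (o1 : Far b u₁ o g) (o2 : Far b (-Complex.I) o g) (o3 : Far b u₃ o g) :
    Pierce (Hyp u₁ (-Complex.I) u₃ b o g) := by
  have m1 : u₁.re ^ 2 + u₁.im ^ 2 = 1 := by rw [← norm_sq_c, n1]; norm_num
  have m3 : u₃.re ^ 2 + u₃.im ^ 2 = 1 := by rw [← norm_sq_c, n3]; norm_num
  have par : ∀ s c : ℝ, s ^ 2 + c ^ 2 = 1 → 0 ≤ c → 0 ≤ s →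
      (1 + (s / (1 + c)) ^ 2) * (1 + c) = 2 ∧ (1 + (s / (1 + c)) ^ 2) * s = 2 * (s / (1 + c)) ∧
      (1 + (s / (1 + c)) ^ 2) * c = 1 - (s / (1 + c)) ^ 2 := by
    intro s c h hc hs
    have : 0 < 1 + c := by linarith
    have e : s / (1 + c) * (1 + c) = s := by field_simp
    set t := s / (1 + c)
    have h2 : (1 + t ^ 2) * (1 + c) = 2 := by
      have : (1 + t ^ 2) * (1 + c) * (1 + c) = 2 * (1 + c) := by
        have : (1 + t ^ 2) * (1 + c) * (1 + c) = (1 + c) ^ 2 + (t * (1 + c)) ^ 2 := by ring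
        rw [this, e]; nlinarith
      exact mul_right_cancel₀ (by positivity) this
    refine ⟨h2, ?_, by linarith⟩
    nth_rewrite 1 [← e]
    have : (1 + t ^ 2) * (t * (1 + c)) = t * ((1 + t ^ 2) * (1 + c)) := by ring
    rw [this, h2]; ring
  obtain ⟨a1, b1, c1⟩ := par (-u₁.re) u₁.im (by linarith) y1 (by linarith)
  obtain ⟨a3, b3, c3⟩ := par u₃.re u₃.im m3 y3 x3
  have z1 : 0 ≤ -u₁.re / (1 + u₁.im) := div_nonneg (by linarith) (by linarith)
  have z3 : 0 ≤ u₃.re / (1 + u₃.im) := div_nonneg (by linarith) (by linarith)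
  set t₁ := -u₁.re / (1 + u₁.im)
  set t₃ := u₃.re / (1 + u₃.im)
  refine stage_t u₁ u₃ t₁ t₃ n1 n3 z1 ?_ ?_ (by linarith) c1 b3 c3 b hb o g hg o1 o2 o3
  · refine abs_le_of_sq_le_sq' ?_ z3 |>.2
    by_contra hc
    push Not at hc
    have : (1 + t₃ ^ 2) * (1 + u₃.im) < (1 + t₁ ^ 2) * (1 + u₁.im) := by
      refine mul_lt_mul (by linarith) (by linarith) (by linarith) (by positivity)
    linarith
  · have d1 : 0 < 1 + t₁ ^ 2 := by positivity
    have d3 : 0 < 1 + t₃ ^ 2 := by positivity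
    have := mul_le_mul_of_nonneg_left hd (mul_pos d1 d3).le
    have e : (1 + t₁ ^ 2) * (1 + t₃ ^ 2) * (u₁.re * u₃.re + u₁.im * u₃.im)
      = -((1 + t₁ ^ 2) * -u₁.re) * ((1 + t₃ ^ 2) * u₃.re) + ((1 + t₁ ^ 2) * u₁.im) * ((1 + t₃ ^ 2) * u₃.im) := by ring
    have e' : (1 + t₁ ^ 2) * (1 + t₃ ^ 2) * -u₃.im = -((1 + t₁ ^ 2) * ((1 + t₃ ^ 2) * u₃.im)) := by ring
    rw [e, e', b1, b3, c1, c3] at this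
    nlinarith

theorem stage_side (u₁ u₃ : ℂ) (n1 : ‖u₁‖ = 1) (n3 : ‖u₃‖ = 1) (x1 : u₁.re ≤ 0) (x3 : 0 ≤ u₃.re)
    (y1 : 0 ≤ u₁.im) (y3 : 0 ≤ u₃.im)
    (hd : -u₃.im ≤ u₁.re * u₃.re + u₁.im * u₃.im) (hd' : -u₁.im ≤ u₁.re * u₃.re + u₁.im * u₃.im)
    (b : ℝ) (hb : 0 ≤ b) (o : ℂ) (g : ℝ) (hg : 0 ≤ g)
    (o1 : Far b u₁ o g) (o2 : Far b (-Complex.I) o g) (o3 : Far b u₃ o g) :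
    Pierce (Hyp u₁ (-Complex.I) u₃ b o g) := by
  rcases le_total u₃.im u₁.im with h | h
  · exact stage_ord u₁ u₃ n1 n3 x1 x3 y1 y3 h hd b hb o g hg o1 o2 o3
  · have eI : mirX (-Complex.I) = -Complex.I := by
      apply Complex.ext
      · rw [mirX_re]; simp
      · rw [mirX_im]
    have o2' := o2.isom mirX
    rw [eI] at o2'
    refine Pierce.isom mirX (stage_ord (mirX u₃) (mirX u₁) ?_ ?_ ?_ ?_ ?_ ?_ ?_ ?_ b hb (mirX o) g hg
      (o3.isom _) o2' (o1.isom _)) ?_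
    · rw [mirX.norm_map, n3]
    · rw [mirX.norm_map, n1]
    · rw [mirX_re]; linarith
    · rw [mirX_re]; linarith
    · rw [mirX_im]; exact y3
    · rw [mirX_im]; exact y1
    · rw [mirX_im, mirX_im]; exact h
    · rw [mirX_im, mirX_im, mirX_re, mirX_re]; linarith
    · intro c ρ h
      have h' := h.isom mirX
      rw [eI] at h'
      obtain ⟨a1, a2, a3, a4, a5, a6, a7⟩ := h'
      exact ⟨a1, a2, a3, a4, a7, a6, a5⟩

theorem stage_down (u₁ u₃ : ℂ) (n1 : ‖u₁‖ = 1) (n3 : ‖u₃‖ = 1) (w₁ w₂ w₃ : ℝ) (hw1 : 0 ≤ w₁) (hw2 : 0 ≤ w₂)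
    (hw3 : 0 ≤ w₃) (hw : w₁ + w₂ + w₃ = 1)
    (sx : w₁ * u₁.re + w₃ * u₃.re = 0) (sy : w₁ * u₁.im + w₃ * u₃.im = w₂)
    (hd : -u₃.im ≤ u₁.re * u₃.re + u₁.im * u₃.im) (hd' : -u₁.im ≤ u₁.re * u₃.re + u₁.im * u₃.im)
    (b : ℝ) (hb : 0 ≤ b) (o : ℂ) (g : ℝ) (hg : 0 ≤ g)
    (o1 : Far b u₁ o g) (o2 : Far b (-Complex.I) o g) (o3 : Far b u₃ o g) :
    Pierce (Hyp u₁ (-Complex.I) u₃ b o g) := by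
  have m1 : u₁.re ^ 2 + u₁.im ^ 2 = 1 := by rw [← norm_sq_c, n1]; norm_num
  have m3 : u₃.re ^ 2 + u₃.im ^ 2 = 1 := by rw [← norm_sq_c, n3]; norm_num
  have l1 : -1 ≤ u₁.im := by nlinarith [sq_nonneg u₁.re]
  have l3 : -1 ≤ u₃.im := by nlinarith [sq_nonneg u₃.re]
  have hw13 : 0 < w₁ + w₃ := by
    by_contra hc
    have r1 : w₁ = 0 := by linarith
    have r3 : w₃ = 0 := by linarith
    rw [r1, r3] at sy
    linarith
  have hx : u₁.re * u₃.re ≤ 0 := by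
    by_contra hc
    push Not at hc
    have := mul_pos hw13 hc
    have q1 : w₁ * u₁.re * u₃.re = -(w₃ * u₃.re ^ 2) := by linear_combination u₃.re * sx
    have q3 : w₃ * u₃.re * u₁.re = -(w₁ * u₁.re ^ 2) := by linear_combination u₁.re * sx
    have p1 := mul_nonneg hw1 (sq_nonneg u₁.re)
    have p3 := mul_nonneg hw3 (sq_nonneg u₃.re)
    linarith
  have y1 : 0 ≤ u₁.im := by
    by_contra hc
    push Not at hc
    have : u₃.im = -1 := by
      by_contra hne
      have : -1 < u₃.im := lt_of_le_of_ne l3 (Ne.symm hne)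
      nlinarith
    rw [this] at sy
    nlinarith
  have y3 : 0 ≤ u₃.im := by
    by_contra hc
    push Not at hc
    have : u₁.im = -1 := by
      by_contra hne
      have : -1 < u₁.im := lt_of_le_of_ne l1 (Ne.symm hne)
      nlinarith
    linarith
  have cases : (u₁.re ≤ 0 ∧ 0 ≤ u₃.re) ∨ (u₃.re ≤ 0 ∧ 0 ≤ u₁.re) := by
    rcases le_total u₁.re 0 with p | p <;> rcases le_total u₃.re 0 with q | q
    · rcases eq_or_lt_of_le p with e | e
      · right; exact ⟨q, e.ge⟩
      · left; exact ⟨p, by nlinarith⟩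
    · left; exact ⟨p, q⟩
    · right; exact ⟨q, p⟩
    · rcases eq_or_lt_of_le p with e | e
      · left; exact ⟨e.ge, q⟩
      · right; exact ⟨by nlinarith, p⟩
  rcases cases with ⟨x1, x3⟩ | ⟨x3, x1⟩
  · exact stage_side u₁ u₃ n1 n3 x1 x3 y1 y3 hd hd' b hb o g hg o1 o2 o3
  · refine (stage_side u₃ u₁ n3 n1 x3 x1 y3 y1 (by linarith) (by linarith) b hb o g hg o3 o2 o1).mono ?_
    rintro c ρ ⟨a1, a2, a3, a4, a5, a6, a7⟩
    exact ⟨a1, a2, a3, a4, a7, a6, a5⟩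

/-- the real inner product -/
def dot (u v : ℂ) : ℝ := u.re * v.re + u.im * v.im

theorem stage_rot (u₁ u₂ u₃ : ℂ) (n1 : ‖u₁‖ = 1) (n2 : ‖u₂‖ = 1) (n3 : ‖u₃‖ = 1) (w₁ w₂ w₃ : ℝ) (hw1 : 0 ≤ w₁) (hw2 : 0 ≤ w₂)
    (hw3 : 0 ≤ w₃) (hw : w₁ + w₂ + w₃ = 1) (hs : w₁ • u₁ + w₂ • u₂ + w₃ • u₃ = 0)
    (hd : dot u₂ u₃ ≤ dot u₁ u₃) (hd' : dot u₁ u₂ ≤ dot u₁ u₃)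
    (b : ℝ) (hb : 0 ≤ b) (o : ℂ) (g : ℝ) (hg : 0 ≤ g)
    (o1 : Far b u₁ o g) (o2 : Far b u₂ o g) (o3 : Far b u₃ o g) :
    Pierce (Hyp u₁ u₂ u₃ b o g) := by
  have m2 : u₂.re ^ 2 + u₂.im ^ 2 = 1 := by rw [← norm_sq_c, n2]; norm_num
  set v : Circle := ⟨-Complex.I * (starRingEnd ℂ) u₂, by
    simp [Submonoid.unitSphere, n2]⟩ with hv
  set e := rotation v with he
  have ev : ∀ c, e c = -Complex.I * (starRingEnd ℂ) u₂ * c := fun c => rotation_apply v c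
  have re : ∀ c, (e c).re = u₂.re * c.im - u₂.im * c.re := by
    intro c; rw [ev]; simp
  have im : ∀ c, (e c).im = -(u₂.re * c.re + u₂.im * c.im) := by
    intro c; rw [ev]; simp; ring
  have e2 : e u₂ = -Complex.I := by
    apply Complex.ext
    · rw [re]; simp; ring
    · rw [im]; simp; nlinarith
  have o2' := o2.isom e
  rw [e2] at o2'
  have hs' : w₁ • e u₁ + w₂ • e u₂ + w₃ • e u₃ = 0 := by
    rw [← map_smul, ← map_smul, ← map_smul, ← map_add, ← map_add, hs, map_zero]
  rw [e2] at hs'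
  have sx := congrArg Complex.re hs'
  have sy := congrArg Complex.im hs'
  simp at sx sy
  have dd : (e u₁).re * (e u₃).re + (e u₁).im * (e u₃).im = dot u₁ u₃ := by
    rw [re, re, im, im, dot]
    linear_combination (u₁.re * u₃.re + u₁.im * u₃.im) * m2
  refine Pierce.isom e (stage_down (e u₁) (e u₃) ?_ ?_ w₁ w₂ w₃ hw1 hw2 hw3 hw ?_ ?_ ?_ ?_ b hb (e o) g hg
    (o1.isom e) o2' (o3.isom e)) ?_
  · rw [e.norm_map, n1]
  · rw [e.norm_map, n3]
  · linarith
  · linarith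
  · rw [dd, im]; unfold dot at *; linarith
  · rw [dd, im]; unfold dot at *; linarith
  · intro c ρ h
    have h' := h.isom e
    rw [e2] at h'
    exact h'

theorem dot_comm (u v : ℂ) : dot u v = dot v u := by unfold dot; ring

theorem stage_all (u₁ u₂ u₃ : ℂ) (n1 : ‖u₁‖ = 1) (n2 : ‖u₂‖ = 1) (n3 : ‖u₃‖ = 1) (w₁ w₂ w₃ : ℝ) (hw1 : 0 ≤ w₁) (hw2 : 0 ≤ w₂)
    (hw3 : 0 ≤ w₃) (hw : w₁ + w₂ + w₃ = 1) (hs : w₁ • u₁ + w₂ • u₂ + w₃ • u₃ = 0)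
    (b : ℝ) (hb : 0 ≤ b) (o : ℂ) (g : ℝ) (hg : 0 ≤ g)
    (o1 : Far b u₁ o g) (o2 : Far b u₂ o g) (o3 : Far b u₃ o g) :
    Pierce (Hyp u₁ u₂ u₃ b o g) := by
  have c12 := dot_comm u₁ u₂
  have c13 := dot_comm u₁ u₃
  have c23 := dot_comm u₂ u₃
  have : (dot u₂ u₃ ≤ dot u₁ u₃ ∧ dot u₁ u₂ ≤ dot u₁ u₃) ∨ (dot u₂ u₃ ≤ dot u₁ u₂ ∧ dot u₁ u₃ ≤ dot u₁ u₂) ∨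
      (dot u₁ u₃ ≤ dot u₂ u₃ ∧ dot u₁ u₂ ≤ dot u₂ u₃) := by
    rcases le_total (dot u₂ u₃) (dot u₁ u₃) with p | p <;> rcases le_total (dot u₁ u₂) (dot u₁ u₃) with q | q <;>
    rcases le_total (dot u₁ u₂) (dot u₂ u₃) with s | s <;> grind
  rcases this with ⟨p, q⟩ | ⟨p, q⟩ | ⟨p, q⟩
  · exact stage_rot u₁ u₂ u₃ n1 n2 n3 w₁ w₂ w₃ hw1 hw2 hw3 hw hs p q b hb o g hg o1 o2 o3
  · refine (stage_rot u₁ u₃ u₂ n1 n3 n2 w₁ w₃ w₂ hw1 hw3 hw2 (by linarith) (by rw [← hs]; abel) (by linarith) (by linarith)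
      b hb o g hg o1 o3 o2).mono ?_
    rintro c ρ ⟨a1, a2, a3, a4, a5, a6, a7⟩
    exact ⟨a1, a2, a3, a4, a5, a7, a6⟩
  · refine (stage_rot u₂ u₁ u₃ n2 n1 n3 w₂ w₁ w₃ hw2 hw1 hw3 (by linarith) (by rw [← hs]; abel) (by linarith) (by linarith)
      b hb o g hg o2 o1 o3).mono ?_
    rintro c ρ ⟨a1, a2, a3, a4, a5, a6, a7⟩
    exact ⟨a1, a2, a3, a4, a6, a5, a7⟩

end Danzer

namespace Danzer

open Filter Topology in
/-- the point minimizing the largest signed distance to the given disks -/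
theorem exists_gap {ι : Type*} (s : Finset ι) (hs : s.Nonempty) (c : ι → ℂ) (r : ι → ℝ) :
    ∃ (O : ℂ) (g : ℝ), (∀ i ∈ s, ‖O - c i‖ ≤ r i + g) ∧ ∀ x, ∃ i ∈ s, r i + g ≤ ‖x - c i‖ := by
  set f : ℂ → ℝ := fun x => s.sup' hs (fun i => ‖x - c i‖ - r i) with hf
  have hc : Continuous f := by
    refine Continuous.finset_sup'_apply hs fun i _ => ?_
    fun_prop
  have ht : Tendsto f (cocompact ℂ) atTop := by
    obtain ⟨i, hi⟩ := hs
    refine tendsto_atTop_mono (f := fun x => ‖x‖ + (-‖c i‖ - r i)) ?_ ?_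
    · intro x
      refine le_trans ?_ (Finset.le_sup' (fun i => ‖x - c i‖ - r i) hi)
      have := norm_sub_norm_le x (c i)
      linarith
    · exact tendsto_atTop_add_const_right _ _ tendsto_norm_cocompact_atTop
  obtain ⟨O, hO⟩ := hc.exists_forall_le ht
  refine ⟨O, f O, ?_, ?_⟩
  · intro i hi
    have := Finset.le_sup' (fun i => ‖O - c i‖ - r i) hi
    have : ‖O - c i‖ - r i ≤ f O := this
    linarith
  · intro x
    obtain ⟨i, hi, h⟩ := Finset.exists_mem_eq_sup' hs (fun i => ‖x - c i‖ - r i)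
    refine ⟨i, hi, ?_⟩
    have h1 := hO x
    have h2 : f x = ‖x - c i‖ - r i := h
    linarith

open Filter Topology in
theorem gap_hull {ι : Type*} (s : Finset ι) (c : ι → ℂ) (r : ι → ℝ) (O : ℂ) (g : ℝ)
    (h1 : ∀ i ∈ s, ‖O - c i‖ ≤ r i + g) (h2 : ∀ x, ∃ i ∈ s, r i + g ≤ ‖x - c i‖) (hpos : ∀ i ∈ s, 0 < r i + g) :
    (0 : ℂ) ∈ convexHull ℝ {u : ℂ | ∃ i ∈ s, ‖u‖ = 1 ∧ c i - O = (r i + g) • u} := by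
  set U := {u : ℂ | ∃ i ∈ s, ‖u‖ = 1 ∧ c i - O = (r i + g) • u} with hU
  have hfin : U.Finite := by
    refine (s.finite_toSet.image (fun i => (r i + g)⁻¹ • (c i - O))).subset ?_
    rintro u ⟨i, hi, -, h⟩
    refine ⟨i, hi, ?_⟩
    simp only [h]
    rw [inv_smul_smul₀ (hpos i hi).ne']
  have act : ∀ i ∈ s, ‖O - c i‖ = r i + g → (r i + g)⁻¹ • (c i - O) ∈ U := by
    intro i hi h
    refine ⟨i, hi, ?_, ?_⟩
    · rw [norm_smul, norm_sub_rev, h, Real.norm_of_nonneg (inv_nonneg.2 (hpos i hi).le),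
        inv_mul_cancel₀ (hpos i hi).ne']
    · rw [smul_inv_smul₀ (hpos i hi).ne']
  have hne : U.Nonempty := by
    obtain ⟨i, hi, h⟩ := h2 O
    exact ⟨_, act i hi (le_antisymm (h1 i hi) h)⟩
  by_contra hn
  have hcpt : IsCompact (convexHull ℝ U) := hfin.isCompact_convexHull ℝ
  obtain ⟨v, hv, hmin⟩ := exists_norm_eq_iInf_of_complete_convex (hne.convexHull (𝕜 := ℝ))
    hcpt.isClosed.isComplete (convex_convexHull ℝ U) (0 : ℂ)
  rw [norm_eq_iInf_iff_real_inner_le_zero (convex_convexHull ℝ U) hv] at hmin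
  have hv0 : 0 < ‖v‖ ^ 2 := by
    have : v ≠ 0 := by rintro rfl; exact hn hv
    positivity
  have hin : ∀ u ∈ U, 0 < inner ℝ v u := by
    intro u hu
    have := hmin u (subset_convexHull ℝ U hu)
    rw [zero_sub, inner_neg_left, inner_sub_right, real_inner_self_eq_norm_sq] at this
    linarith
  have ev : ∀ i ∈ s, ∀ᶠ ε : ℝ in 𝓝[>] 0, ‖(O + ε • v) - c i‖ < r i + g := by
    intro i hi
    rcases eq_or_lt_of_le (h1 i hi) with h | h
    · have hd := hin _ (act i hi h)
      rw [inner_smul_right] at hd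
      have hd2 : 0 < inner ℝ v (c i - O) := by
        have := mul_pos (hpos i hi) hd
        rwa [← mul_assoc, mul_inv_cancel₀ (hpos i hi).ne', one_mul] at this
      have e1 : ∀ᶠ ε : ℝ in 𝓝[>] 0, ε * ‖v‖ ^ 2 < 2 * inner ℝ v (c i - O) := by
        have : Tendsto (fun ε : ℝ => ε * ‖v‖ ^ 2) (𝓝[>] 0) (𝓝 (0 * ‖v‖ ^ 2)) :=
          tendsto_nhdsWithin_of_tendsto_nhds ((continuous_id.mul continuous_const).tendsto 0)
        rw [zero_mul] at this
        exact this.eventually (gt_mem_nhds (by linarith))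
      filter_upwards [e1, self_mem_nhdsWithin] with ε he h0
      have h0 : 0 < ε := h0
      have e : (O + ε • v) - c i = ε • v - (c i - O) := by abel
      refine lt_of_pow_lt_pow_left₀ 2 (hpos i hi).le ?_
      rw [e, norm_sub_sq_real, ← norm_neg (c i - O), neg_sub, h, norm_smul, inner_smul_left, mul_pow,
        Real.norm_eq_abs, sq_abs]
      have := mul_lt_mul_of_pos_left he h0
      simp only [conj_trivial]
      nlinarith
    · have : Tendsto (fun ε : ℝ => ‖(O + ε • v) - c i‖) (𝓝[>] 0) (𝓝 ‖(O + (0 : ℝ) • v) - c i‖) := by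
        refine tendsto_nhdsWithin_of_tendsto_nhds (Continuous.tendsto ?_ 0)
        fun_prop
      rw [zero_smul, add_zero] at this
      exact this.eventually (gt_mem_nhds h)
  have all := (Filter.eventually_all_finset s).2 ev
  obtain ⟨ε, hε⟩ := all.exists
  obtain ⟨i, hi, h⟩ := h2 (O + ε • v)
  exact absurd (hε i hi) (not_lt.2 h)

/-- Carathéodory in the plane, padded to three points -/
theorem cara (U : Set ℂ) (h : (0 : ℂ) ∈ convexHull ℝ U) :
    ∃ u₁ ∈ U, ∃ u₂ ∈ U, ∃ u₃ ∈ U, ∃ w₁ w₂ w₃ : ℝ, 0 ≤ w₁ ∧ 0 ≤ w₂ ∧ 0 ≤ w₃ ∧ w₁ + w₂ + w₃ = 1 ∧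
      w₁ • u₁ + w₂ • u₂ + w₃ • u₃ = 0 := by
  obtain ⟨κ, hκ, z, w, hz, hai, hw, hw1, hs⟩ := eq_pos_convex_span_of_mem_convexHull h
  have hcard : Fintype.card κ ≤ 3 := by
    have := hai.card_le_finrank_succ
    have h2 : Module.finrank ℝ (vectorSpan ℝ (Set.range z)) ≤ Module.finrank ℝ ℂ := Submodule.finrank_le _
    rw [Complex.finrank_real_complex] at h2
    omega
  have hzU : ∀ k, z k ∈ U := fun k => hz ⟨k, rfl⟩
  obtain ⟨n, hn⟩ : ∃ n, n = Fintype.card κ := ⟨_, rfl⟩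
  have e : Fin n ≃ κ := (finCongr hn).trans (Fintype.equivFin κ).symm
  rw [← hn] at hcard
  rw [← e.sum_comp] at hw1 hs
  interval_cases n
  · simp at hw1
  · simp only [Fin.sum_univ_one] at hw1 hs
    exact ⟨_, hzU (e 0), _, hzU (e 0), _, hzU (e 0), w (e 0), 0, 0, (hw _).le, le_rfl, le_rfl, by linarith, by simpa using hs⟩
  · simp only [Fin.sum_univ_two] at hw1 hs
    exact ⟨_, hzU (e 0), _, hzU (e 1), _, hzU (e 1), w (e 0), w (e 1), 0, (hw _).le, (hw _).le, le_rfl, by linarith,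
      by simpa using hs⟩
  · simp only [Fin.sum_univ_three] at hw1 hs
    exact ⟨_, hzU (e 0), _, hzU (e 1), _, hzU (e 2), w (e 0), w (e 1), w (e 2), (hw _).le, (hw _).le, (hw _).le, hw1, hs⟩

/-- the normalized form of the theorem -/
theorem core {ι : Type*} [Fintype ι] (c : ι → ℂ) (r : ι → ℝ) (hr : ∀ i, 0 ≤ r i)
    (hp : ∀ i j, ‖c i - c j‖ ≤ r i + r j) (hno : ∀ x, ∃ i, r i ≤ 1000 ∧ r i < ‖x - c i‖)
    (z : ℂ) (hz : ∀ i, r i < 1000 → ‖z - c i‖ ≤ r i) :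
    ∃ pts : List ℂ, pts.length ≤ 4 ∧ ∀ i, ∃ p ∈ pts, ‖p - c i‖ ≤ r i := by
  classical
  set P := Finset.univ.filter (fun i => r i ≤ 1000) with hP
  have memP : ∀ i, i ∈ P ↔ r i ≤ 1000 := by intro i; simp [hP]
  have hPne : P.Nonempty := by
    obtain ⟨i, hi, -⟩ := hno 0
    exact ⟨i, (memP i).2 hi⟩
  obtain ⟨O, b, b1, b2⟩ := exists_gap P hPne c r
  obtain ⟨o, g, g1, g2⟩ := exists_gap Finset.univ ⟨hPne.choose, Finset.mem_univ _⟩ c r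
  have hb : 0 < b := by
    obtain ⟨i, hi, h⟩ := hno O
    have := b1 i ((memP i).2 hi)
    linarith
  have hg : 0 < g := by
    obtain ⟨i, hi, h⟩ := hno o
    have := g1 i (Finset.mem_univ _)
    linarith
  have hgr : ∀ i, g ≤ r i := by
    intro i
    obtain ⟨j, -, h⟩ := g2 (c i)
    have := hp i j
    linarith
  have hull := gap_hull P c r O b b1 b2 (fun i _ => by linarith [hr i])
  obtain ⟨u₁, ⟨i₁, p1, n1, e1⟩, u₂, ⟨i₂, p2, n2, e2⟩, u₃, ⟨i₃, p3, n3, e3⟩, w₁, w₂, w₃, hw1, hw2, hw3, hw, hs⟩ := cara _ hull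
  rw [memP] at p1 p2 p3
  have far0 : ∀ (x : ℂ) (ρ : ℝ) (i : ι) (u : ℂ), r i ≤ 1000 → ‖u‖ = 1 → c i - O = (r i + b) • u → ‖x - c i‖ ≤ ρ + r i →
      ‖(x - O) - (1000 + b) • u‖ ≤ ρ + 1000 := by
    intro x ρ i u hi hu he hx
    have : (x - O) - (1000 + b) • u = (x - c i) - (1000 - r i) • u := by
      have e : x - O = (x - c i) + (c i - O) := by abel
      rw [e, he]
      module
    rw [this]
    refine (norm_sub_le _ _).trans ?_
    rw [norm_smul, hu, mul_one, Real.norm_of_nonneg (by linarith)]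
    linarith
  have far1 : ∀ (x : ℂ) (ρ : ℝ), 0 ≤ ρ → (∀ i, ‖x - c i‖ ≤ ρ + r i) →
      Far b u₁ (x - O) ρ ∧ Far b u₂ (x - O) ρ ∧ Far b u₃ (x - O) ρ := by
    intro x ρ hρ hx
    have f1 := far0 x ρ i₁ u₁ p1 n1 e1 (hx i₁)
    have f2 := far0 x ρ i₂ u₂ p2 n2 e2 (hx i₂)
    have f3 := far0 x ρ i₃ u₃ p3 n3 e3 (hx i₃)
    generalize x - O = C at f1 f2 f3 ⊢
    have sq : ∀ u : ℂ, ‖u‖ = 1 → ‖C - (1000 + b) • u‖ ≤ ρ + 1000 →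
        ‖C‖ ^ 2 - 2 * (1000 + b) * inner ℝ C u + (1000 + b) ^ 2 ≤ (ρ + 1000) ^ 2 := by
      intro u hu h
      have := pow_le_pow_left₀ (norm_nonneg _) h 2
      rw [norm_sub_sq_real, norm_smul, hu, inner_smul_right, mul_one, Real.norm_of_nonneg (by linarith)] at this
      linarith
    have hC : ‖C‖ ≤ ρ + 1000 := by
      have k1 := mul_le_mul_of_nonneg_left (sq u₁ n1 f1) hw1
      have k2 := mul_le_mul_of_nonneg_left (sq u₂ n2 f2) hw2
      have k3 := mul_le_mul_of_nonneg_left (sq u₃ n3 f3) hw3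
      have hin : w₁ * inner ℝ C u₁ + w₂ * inner ℝ C u₂ + w₃ * inner ℝ C u₃ = 0 := by
        rw [← inner_smul_right, ← inner_smul_right, ← inner_smul_right, ← inner_add_right, ← inner_add_right, hs,
          inner_zero_right]
      refine (abs_le_of_sq_le_sq' ?_ (by linarith)).2
      have id : w₁ * (‖C‖ ^ 2 - 2 * (1000 + b) * inner ℝ C u₁ + (1000 + b) ^ 2)
        + w₂ * (‖C‖ ^ 2 - 2 * (1000 + b) * inner ℝ C u₂ + (1000 + b) ^ 2)
        + w₃ * (‖C‖ ^ 2 - 2 * (1000 + b) * inner ℝ C u₃ + (1000 + b) ^ 2) =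
        (w₁ + w₂ + w₃) * (‖C‖ ^ 2 + (1000 + b) ^ 2)
        - 2 * (1000 + b) * (w₁ * inner ℝ C u₁ + w₂ * inner ℝ C u₂ + w₃ * inner ℝ C u₃) := by ring
      have id2 : w₁ * (ρ + 1000) ^ 2 + w₂ * (ρ + 1000) ^ 2 + w₃ * (ρ + 1000) ^ 2 = (w₁ + w₂ + w₃) * (ρ + 1000) ^ 2 := by ring
      rw [hin, hw] at id
      rw [hw] at id2
      nlinarith [sq_nonneg (1000 + b)]
    have conv : ∀ u : ℂ, ‖C - (1000 + b) • u‖ ≤ ρ + 1000 → Far b u C ρ := by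
      intro u hu a h0 h1
      have hB : 0 < 1000 + b := by linarith
      have l0 : 0 ≤ a / (1000 + b) := div_nonneg h0 hB.le
      have l1 : 0 ≤ 1 - a / (1000 + b) := by
        rw [sub_nonneg, div_le_one hB]; exact h1
      have e : C - a • u = (1 - a / (1000 + b)) • C + (a / (1000 + b)) • (C - (1000 + b) • u) := by
        rw [smul_sub, smul_smul, div_mul_cancel₀ _ hB.ne', sub_smul, one_smul]
        abel
      rw [e]
      refine (norm_add_le _ _).trans ?_
      rw [norm_smul, norm_smul, Real.norm_of_nonneg l0, Real.norm_of_nonneg l1]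
      nlinarith [mul_le_mul_of_nonneg_left hC l1, mul_le_mul_of_nonneg_left hu l0]
    exact ⟨conv u₁ f1, conv u₂ f2, conv u₃ f3⟩
  obtain ⟨o1, o2, o3⟩ := far1 o g hg.le (fun i => by linarith [g1 i (Finset.mem_univ i)])
  have fin := stage_all u₁ u₂ u₃ n1 n2 n3 w₁ w₂ w₃ hw1 hw2 hw3 hw hs b hb.le (o - O) g hg.le o1 o2 o3
  have hyp : ∀ i, Hyp u₁ u₂ u₃ b (o - O) g (c i - O) (r i) := by
    intro i
    refine ⟨hr i, hgr i, ?_, ?_, far1 (c i) (r i) (hr i) (hp i)⟩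
    · have := g1 i (Finset.mem_univ i)
      rw [sub_sub_sub_cancel_right, norm_sub_rev]
      exact this
    · intro h
      rw [norm_sub_rev]
      exact b1 i ((memP i).2 h)
  have tr : ∀ i p, ‖(p + O) - c i‖ = ‖(c i - O) - p‖ := by
    intro i p
    rw [← norm_neg]; congr 1; abel
  rcases fin with ⟨pts, l, h⟩ | ⟨pts, l, h⟩
  · refine ⟨z :: pts.map (· + O), by simp; omega, fun i => ?_⟩
    rcases lt_or_ge (r i) 1000 with hi | hi
    · exact ⟨z, List.mem_cons_self, hz i hi⟩
    · obtain ⟨p, q1, q2⟩ := h _ _ hi (hyp i)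
      exact ⟨p + O, List.mem_cons_of_mem _ (List.mem_map_of_mem (f := (· + O)) q1), by rw [tr]; exact q2⟩
  · refine ⟨pts.map (· + O), by simpa using l, fun i => ?_⟩
    obtain ⟨p, q1, q2⟩ := h _ _ (hyp i)
    exact ⟨p + O, List.mem_map_of_mem (f := (· + O)) q1, by rw [tr]; exact q2⟩

theorem danzerC {ι : Type*} [Fintype ι] (c : ι → ℂ) (r : ι → ℝ) (hr : ∀ i, 0 ≤ r i)
    (hp : ∀ i j, ‖c i - c j‖ ≤ r i + r j) :
    ∃ pts : List ℂ, pts.length ≤ 4 ∧ ∀ i, ∃ p ∈ pts, ‖p - c i‖ ≤ r i := by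
  classical
  by_cases hcom : ∃ x, ∀ i, ‖x - c i‖ ≤ r i
  · obtain ⟨x, hx⟩ := hcom
    exact ⟨[x], by simp, fun i => ⟨x, by simp, hx i⟩⟩
  have hne : Nonempty ι := by
    by_contra h
    rw [not_nonempty_iff] at h
    exact hcom ⟨0, fun i => (h.false i).elim⟩
  set B := Finset.univ.filter (fun j => ¬ ∃ x, ∀ i, r i ≤ r j → ‖x - c i‖ ≤ r i) with hB
  have hBne : B.Nonempty := by
    obtain ⟨j, -, hj⟩ := Finset.exists_max_image Finset.univ r Finset.univ_nonempty
    refine ⟨j, ?_⟩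
    simp only [hB, Finset.mem_filter, Finset.mem_univ, true_and]
    rintro ⟨x, hx⟩
    exact hcom ⟨x, fun i => hx i (hj i (Finset.mem_univ _))⟩
  obtain ⟨j, hjB, hj⟩ := Finset.exists_min_image B r hBne
  have hjn : ¬ ∃ x, ∀ i, r i ≤ r j → ‖x - c i‖ ≤ r i := by
    simpa only [hB, Finset.mem_filter, Finset.mem_univ, true_and] using hjB
  have hz : ∃ z, ∀ i, r i < r j → ‖z - c i‖ ≤ r i := by
    by_cases hS : (Finset.univ.filter (fun i => r i < r j)).Nonempty
    · obtain ⟨k, hk, hkm⟩ := Finset.exists_max_image _ r hS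
      have hk : r k < r j := by simpa using hk
      have : k ∉ B := fun h => absurd (hj k h) (not_le.2 hk)
      simp only [hB, Finset.mem_filter, Finset.mem_univ, true_and, not_not] at this
      obtain ⟨z, hz⟩ := this
      exact ⟨z, fun i hi => hz i (hkm i (by simpa using hi))⟩
    · refine ⟨0, fun i hi => (hS ⟨i, by simpa using hi⟩).elim⟩
  obtain ⟨z, hz⟩ := hz
  have hrj : 0 < r j := by
    rcases eq_or_lt_of_le (hr j) with h | h
    · exfalso
      refine hjn ⟨c j, fun i hi => ?_⟩
      have := hp j i
      linarith
    · exact h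
  have hl : 0 < 1000 / r j := by positivity
  set l := 1000 / r j with hldef
  have hlr : l * r j = 1000 := by rw [hldef]; field_simp
  have ns : ∀ x i, ‖l • x - l • c i‖ = l * ‖x - c i‖ := by
    intro x i
    rw [← smul_sub, norm_smul, Real.norm_of_nonneg hl.le]
  have cmp : ∀ i, l * r i ≤ 1000 ↔ r i ≤ r j := by
    intro i; rw [← hlr, mul_le_mul_iff_right₀ hl]
  have cmp' : ∀ i, l * r i < 1000 ↔ r i < r j := by
    intro i; rw [← hlr, mul_lt_mul_iff_right₀ hl]
  have A1 : ∀ i k, ‖l • c i - l • c k‖ ≤ l * r i + l * r k := by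
    intro i k
    have := mul_le_mul_of_nonneg_left (hp i k) hl.le
    rw [ns]
    linarith
  have A2 : ∀ x, ∃ i, l * r i ≤ 1000 ∧ l * r i < ‖x - l • c i‖ := by
    intro x
    push Not at hjn
    obtain ⟨i, k1, k2⟩ := hjn (l⁻¹ • x)
    refine ⟨i, (cmp i).2 k1, ?_⟩
    have := ns (l⁻¹ • x) i
    rw [smul_inv_smul₀ hl.ne'] at this
    rw [this]
    exact mul_lt_mul_of_pos_left k2 hl
  have A3 : ∀ i, l * r i < 1000 → ‖l • z - l • c i‖ ≤ l * r i := by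
    intro i hi
    rw [ns]
    exact mul_le_mul_of_nonneg_left (hz i ((cmp' i).1 hi)) hl.le
  obtain ⟨pts, h1, h2⟩ := core (fun i => l • c i) (fun i => l * r i) (fun i => mul_nonneg hl.le (hr i)) A1 A2 (l • z) A3
  refine ⟨pts.map (l⁻¹ • ·), by simpa using h1, fun i => ?_⟩
  obtain ⟨p, q1, q2⟩ := h2 i
  refine ⟨l⁻¹ • p, List.mem_map_of_mem (f := (l⁻¹ • ·)) q1, ?_⟩
  have := ns (l⁻¹ • p) i
  rw [smul_inv_smul₀ hl.ne'] at this
  rw [this] at q2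
  exact le_of_mul_le_mul_left q2 hl

end Danzer

/-- Danzer's theorem: a finite family of pairwise intersecting closed disks in the
plane can be pierced by at most `4` points. -/
theorem danzer {ι : Type*} [Fintype ι]
    (F : ι → Set (EuclideanSpace ℝ (Fin 2)))
    (hdisk : ∀ i, ∃ (c : EuclideanSpace ℝ (Fin 2)) (r : ℝ), 0 ≤ r ∧
      F i = Metric.closedBall c r)
    (hpair : ∀ i j, (F i ∩ F j).Nonempty) :
    ∃ C : Finset (EuclideanSpace ℝ (Fin 2)), C.card ≤ 4 ∧ ∀ i, ∃ x ∈ C, x ∈ F i := by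
  classical
  choose c r hr hF using hdisk
  let e : ℂ ≃ₗᵢ[ℝ] EuclideanSpace ℝ (Fin 2) := Complex.orthonormalBasisOneI.repr
  obtain ⟨pts, h1, h2⟩ := Danzer.danzerC (fun i => e.symm (c i)) r hr (by
    intro i j
    obtain ⟨x, hx, hy⟩ := hpair i j
    rw [hF, Metric.mem_closedBall] at hx hy
    rw [← map_sub, LinearIsometryEquiv.norm_map, ← dist_eq_norm]
    have := dist_triangle_left (c i) (c j) x
    linarith)
  refine ⟨(pts.map e).toFinset, (List.toFinset_card_le _).trans (by simpa using h1), fun i => ?_⟩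
  obtain ⟨p, q1, q2⟩ := h2 i
  refine ⟨e p, List.mem_toFinset.2 (List.mem_map_of_mem q1), ?_⟩
  rw [hF, Metric.mem_closedBall, dist_eq_norm, ← e.symm.norm_map, map_sub, e.symm_apply_apply]
  exact q2
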